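/- arXiv:2101.10316 — 2 statements merged into one kernel-verified Lean document; each statement's English description precedes it below -/
import Mathlib

section
/- For every integer n ≥ 2, every h ∈ Thompson's group F satisfying h⁻¹ fₙ h = gₙ has ℓ(h) ≥ (n² − 5n − 4)/2. -/
noncomputable section

open Set

noncomputable section

open Set

def x0fun : ℝ → ℝ := fun t =>
  if t < 0 then t
  else if t ≤ 1/2 then t / 2
  else if t ≤ 3/4 then t - 1/4
  else if t ≤ 1 then 2 * t - 1
  else t

def x0inv : ℝ → ℝ := fun t =>
  if t < 0 then t
  else if t ≤ 1/4 then 2 * t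
  else if t ≤ 1/2 then t + 1/4
  else if t ≤ 1 then (t + 1) / 2
  else t

/-- The generator `x₀` of Thompson's group `F`, as a permutation of `ℝ`
(the identity outside `[0,1]`). -/
def x0 : Equiv.Perm ℝ where
  toFun := x0fun
  invFun := x0inv
  left_inv := by
    intro t
    show x0inv (x0fun t) = t
    unfold x0fun
    split_ifs <;> (unfold x0inv; split_ifs <;> linarith)
  right_inv := by
    intro t
    show x0fun (x0inv t) = t
    unfold x0inv
    split_ifs <;> (unfold x0fun; split_ifs <;> linarith)

def x1fun : ℝ → ℝ := fun t =>
  if t < 0 then t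
  else if t ≤ 1/2 then t
  else if t ≤ 3/4 then t / 2 + 1/4
  else if t ≤ 7/8 then t - 1/8
  else if t ≤ 1 then 2 * t - 1
  else t

def x1inv : ℝ → ℝ := fun t =>
  if t < 0 then t
  else if t ≤ 1/2 then t
  else if t ≤ 5/8 then 2 * t - 1/2
  else if t ≤ 3/4 then t + 1/8
  else if t ≤ 1 then (t + 1) / 2
  else t

set_option maxHeartbeats 2000000 in
/-- The generator `x₁` of Thompson's group `F`, as a permutation of `ℝ`
(the identity outside `[0,1]`). -/
def x1 : Equiv.Perm ℝ where
  toFun := x1fun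
  invFun := x1inv
  left_inv := by
    intro t
    show x1inv (x1fun t) = t
    unfold x1fun
    split_ifs <;> (unfold x1inv; split_ifs <;> linarith)
  right_inv := by
    intro t
    show x1fun (x1inv t) = t
    unfold x1inv
    split_ifs <;> (unfold x1fun; split_ifs <;> linarith)

/-- Thompson's group `F`: the subgroup generated by `x₀` and `x₁`. -/
def ThompsonF : Subgroup (Equiv.Perm ℝ) :=
  Subgroup.closure ({x0, x1} : Set (Equiv.Perm ℝ))

/-- Word length with respect to the generating set `{x₀, x₁}`. -/
def wordLength (f : Equiv.Perm ℝ) : ℕ :=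
  sInf {n | ∃ w : List (Equiv.Perm ℝ), w.length = n ∧
    (∀ g ∈ w, g ∈ ({x0, x1, x0⁻¹, x1⁻¹} : Set (Equiv.Perm ℝ))) ∧ w.prod = f}
/-- The element `fₙ = x₀(x₁⁻¹x₀⁻¹x₁x₀⁻¹)^{n−1} x₁⁻² (x₀x₁x₀x₁⁻¹)^{n−1}` of `F`. -/
def fEl (n : ℕ) : Equiv.Perm ℝ :=
  x0 * (x1⁻¹ * x0⁻¹ * x1 * x0⁻¹) ^ (n - 1) * x1⁻¹ ^ 2 * (x0 * x1 * x0 * x1⁻¹) ^ (n - 1)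

/-- The element `gₙ = x₀(x₁⁻²x₀⁻¹x₁x₀⁻¹)^{n−1} x₁⁻² (x₀x₁x₀)^{n−1}` of `F`. -/
def gEl (n : ℕ) : Equiv.Perm ℝ :=
  x0 * (x1⁻¹ ^ 2 * x0⁻¹ * x1 * x0⁻¹) ^ (n - 1) * x1⁻¹ ^ 2 * (x0 * x1 * x0) ^ (n - 1)


section GeneratorValues

variable {t : ℝ}

lemma x0_apply_left (h₀ : 0 ≤ t) (h₁ : t ≤ 1 / 2) : x0 t = t / 2 := by
  change x0fun t = _
  unfold x0fun
  split_ifs <;> linarith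

lemma x0_apply_mid (h₀ : 1 / 2 ≤ t) (h₁ : t ≤ 3 / 4) : x0 t = t - 1 / 4 := by
  change x0fun t = _
  unfold x0fun
  split_ifs <;> linarith

lemma x0_apply_right (h₀ : 3 / 4 ≤ t) (h₁ : t ≤ 1) : x0 t = 2 * t - 1 := by
  change x0fun t = _
  unfold x0fun
  split_ifs <;> linarith

lemma x0_inv_apply_left (h₀ : 0 ≤ t) (h₁ : t ≤ 1 / 4) : x0⁻¹ t = 2 * t := by
  change x0inv t = _
  unfold x0inv
  split_ifs <;> linarith

lemma x0_inv_apply_mid (h₀ : 1 / 4 ≤ t) (h₁ : t ≤ 1 / 2) : x0⁻¹ t = t + 1 / 4 := by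
  change x0inv t = _
  unfold x0inv
  split_ifs <;> linarith

lemma x0_inv_apply_right (h₀ : 1 / 2 ≤ t) (h₁ : t ≤ 1) : x0⁻¹ t = (t + 1) / 2 := by
  change x0inv t = _
  unfold x0inv
  split_ifs <;> linarith

lemma x1_apply_left (h₀ : 0 ≤ t) (h₁ : t ≤ 1 / 2) : x1 t = t := by
  change x1fun t = _
  unfold x1fun
  split_ifs <;> linarith

lemma x1_apply_mid (h₀ : 1 / 2 ≤ t) (h₁ : t ≤ 3 / 4) : x1 t = t / 2 + 1 / 4 := by
  change x1fun t = _
  unfold x1fun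
  split_ifs <;> linarith

lemma x1_apply_mid' (h₀ : 3 / 4 ≤ t) (h₁ : t ≤ 7 / 8) : x1 t = t - 1 / 8 := by
  change x1fun t = _
  unfold x1fun
  split_ifs <;> linarith

lemma x1_apply_right (h₀ : 7 / 8 ≤ t) (h₁ : t ≤ 1) : x1 t = 2 * t - 1 := by
  change x1fun t = _
  unfold x1fun
  split_ifs <;> linarith

lemma x1_inv_apply_left (h₀ : 0 ≤ t) (h₁ : t ≤ 1 / 2) : x1⁻¹ t = t := by
  change x1inv t = _
  unfold x1inv
  split_ifs <;> linarith

lemma x1_inv_apply_mid (h₀ : 1 / 2 ≤ t) (h₁ : t ≤ 5 / 8) : x1⁻¹ t = 2 * t - 1 / 2 := by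
  change x1inv t = _
  unfold x1inv
  split_ifs <;> linarith

lemma x1_inv_apply_mid' (h₀ : 5 / 8 ≤ t) (h₁ : t ≤ 3 / 4) : x1⁻¹ t = t + 1 / 8 := by
  change x1inv t = _
  unfold x1inv
  split_ifs <;> linarith

lemma x1_inv_apply_right (h₀ : 3 / 4 ≤ t) (h₁ : t ≤ 1) : x1⁻¹ t = (t + 1) / 2 := by
  change x1inv t = _
  unfold x1inv
  split_ifs <;> linarith

end GeneratorValues

/-! ### Closed forms of `fₙ` and `gₙ` -/

lemma fEl_two_add (m : ℕ) (t : ℝ) :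
    fEl (m + 2) t = (x0 * x1⁻¹ * x0⁻¹ * x1 * x0⁻¹ * x0⁻¹)
      (fEl (m + 1) ((x0 * x1 * x0 * x1⁻¹) t)) := by
  rw [← Equiv.Perm.mul_apply, ← Equiv.Perm.mul_apply]
  congr 1
  simp only [fEl, Nat.add_sub_cancel, show m + 2 - 1 = m + 1 by omega]
  rw [pow_succ' (_ * _ * _ * x0⁻¹), pow_succ (_ * _ * x0 * _)]
  simp only [mul_assoc, inv_mul_cancel_left]

lemma gEl_two_add (m : ℕ) (t : ℝ) :
    gEl (m + 2) t = (x0 * x1⁻¹ * x1⁻¹ * x0⁻¹ * x1 * x0⁻¹ * x0⁻¹)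
      (gEl (m + 1) ((x0 * x1 * x0) t)) := by
  rw [← Equiv.Perm.mul_apply, ← Equiv.Perm.mul_apply]
  congr 1
  simp only [gEl, Nat.add_sub_cancel, show m + 2 - 1 = m + 1 by omega]
  rw [pow_succ' (_ * _ * _ * x0⁻¹), pow_succ (_ * _ * x0)]
  simp only [mul_assoc, inv_mul_cancel_left, pow_two]

lemma fEl_apply_left (m : ℕ) {t : ℝ} (h₀ : 0 ≤ t) (h₁ : t ≤ 1 / 2) :
    fEl (m + 1) t = t / 2 := by
  induction m generalizing t with
  | zero =>
    simp (disch := grind) only [fEl, zero_add, Nat.sub_self, pow_zero, mul_one, pow_two,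
      Equiv.Perm.mul_apply, x1_inv_apply_left, x0_apply_left]
  | succ m ih =>
    rw [fEl_two_add]
    simp (disch := grind) only [Equiv.Perm.mul_apply, x1_inv_apply_left, x0_apply_left,
      x1_apply_left, ih, x0_inv_apply_left]
    linarith

lemma gEl_apply_left (m : ℕ) {t : ℝ} (h₀ : 0 ≤ t) (h₁ : t ≤ 1 / 2) :
    gEl (m + 1) t = t / 2 := by
  induction m generalizing t with
  | zero =>
    simp (disch := grind) only [gEl, zero_add, Nat.sub_self, pow_zero, mul_one, pow_two,
      Equiv.Perm.mul_apply, x1_inv_apply_left, x0_apply_left]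
  | succ m ih =>
    rw [gEl_two_add]
    simp (disch := grind) only [Equiv.Perm.mul_apply, x1_inv_apply_left, x0_apply_left,
      x1_apply_left, ih, x0_inv_apply_left]
    linarith

lemma fEl_apply_scale (m : ℕ) {v w : ℝ} (hv₀ : 0 ≤ v) (hv : v ≤ 1 / 8) (hw₀ : 0 ≤ w)
    (hw : w ≤ 3 / 4) (h : fEl (m + 1) (1 - 4 * v) = 1 - w) :
    fEl (m + 2) (1 - v) = 1 - w / 4 := by
  have hB : (x0 * x1 * x0 * x1⁻¹) (1 - v) = 1 - 4 * v := by
    simp (disch := grind) only [Equiv.Perm.mul_apply, x1_inv_apply_right, x0_apply_right,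
      x1_apply_right]
    linarith
  rw [fEl_two_add, hB, h]
  rcases le_total w (1 / 2) with hw' | hw'
  · rcases le_total w (1 / 4) with hw'' | hw''
    · simp (disch := grind) only [Equiv.Perm.mul_apply, x1_inv_apply_right, x0_apply_right,
        x1_apply_right, x0_inv_apply_right]
      linarith
    · simp (disch := grind) only [Equiv.Perm.mul_apply, x1_inv_apply_right, x0_apply_right,
        x1_apply_right, x0_inv_apply_right]
      linarith
  · simp (disch := grind) only [Equiv.Perm.mul_apply, x1_inv_apply_right, x0_apply_right,
      x1_apply_mid', x0_inv_apply_right, x0_inv_apply_mid]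
    linarith

lemma gEl_apply_scale (m : ℕ) {v w : ℝ} (hv₀ : 0 ≤ v) (hv : v ≤ 1 / 16) (hw₀ : 0 ≤ w)
    (hw : w ≤ 3 / 4) (h : gEl (m + 1) (1 - 8 * v) = 1 - w) :
    gEl (m + 2) (1 - v) = 1 - w / 8 := by
  have hB : (x0 * x1 * x0) (1 - v) = 1 - 8 * v := by
    simp (disch := grind) only [Equiv.Perm.mul_apply, x0_apply_right, x1_apply_right]
    linarith
  rw [gEl_two_add, hB, h]
  rcases le_total w (1 / 2) with hw' | hw'
  · simp (disch := grind) only [Equiv.Perm.mul_apply, x1_inv_apply_right, x0_apply_right,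
      x1_apply_right, x0_inv_apply_right]
    linarith
  · simp (disch := grind) only [Equiv.Perm.mul_apply, x1_inv_apply_right, x0_apply_right,
      x1_apply_mid', x0_inv_apply_right, x0_inv_apply_mid]
    linarith

lemma fEl_apply_expanding (m K : ℕ) (hK : K ≤ m) {v : ℝ} (h₀ : 3 / 8 * (1 / 4) ^ K ≤ v)
    (h₁ : v ≤ 1 / 2 * (1 / 4) ^ K) :
    fEl (m + 2) (1 - v) = 1 - (4 * v - 5 / 4 * (1 / 4) ^ K) := by
  induction K generalizing m v with
  | zero =>
    simp only [pow_zero, mul_one] at h₀ h₁ ⊢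
    rw [fEl_two_add]
    rcases le_total v (7 / 16) with hv | hv
    · simp (disch := grind) only [Equiv.Perm.mul_apply, x1_inv_apply_mid, x0_apply_mid,
        x1_apply_left, x0_apply_left, fEl_apply_left, x0_inv_apply_left, x0_inv_apply_mid,
        x1_inv_apply_mid', x0_apply_right]
      linarith
    · simp (disch := grind) only [Equiv.Perm.mul_apply, x1_inv_apply_mid, x0_apply_mid,
        x1_apply_left, x0_apply_left, fEl_apply_left, x0_inv_apply_left, x0_inv_apply_mid]
      linarith
  | succ K ih =>
    obtain ⟨m, rfl⟩ : ∃ m', m = m' + 1 := ⟨m - 1, by omega⟩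
    have hy : (0 : ℝ) < (1 / 4) ^ K := by positivity
    have hy1 : ((1 : ℝ) / 4) ^ K ≤ 1 := pow_le_one₀ (by norm_num) (by norm_num)
    rw [pow_succ] at h₀ h₁ ⊢
    rw [fEl_apply_scale (m + 1) (w := 4 * (4 * v) - 5 / 4 * (1 / 4) ^ K) (by linarith)
      (by linarith) (by linarith) (by linarith)
      (ih m (by omega) (by linarith) (by linarith))]
    linarith

lemma fEl_apply_contracting (m K : ℕ) (hK : K ≤ m) {v : ℝ} (h₀ : 1 / 8 * (1 / 4) ^ K ≤ v)
    (h₁ : v ≤ 3 / 8 * (1 / 4) ^ K) :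
    fEl (m + 2) (1 - v) = 1 - (v / 4 + 5 / 32 * (1 / 4) ^ K) := by
  induction K generalizing m v with
  | zero =>
    simp only [pow_zero, mul_one] at h₀ h₁ ⊢
    rw [fEl_two_add]
    have hB : (x0 * x1 * x0 * x1⁻¹) (1 - v) = 5 / 8 - v := by
      rcases le_total v (1 / 4) with hv | hv
      · simp (disch := grind) only [Equiv.Perm.mul_apply, x1_inv_apply_right, x0_apply_right,
          x1_apply_mid', x0_apply_mid]
        linarith
      · simp (disch := grind) only [Equiv.Perm.mul_apply, x1_inv_apply_mid', x0_apply_right,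
          x1_apply_mid, x0_apply_mid]
        linarith
    rw [hB]
    simp (disch := grind) only [Equiv.Perm.mul_apply, fEl_apply_left, x0_inv_apply_left,
      x0_inv_apply_mid, x1_apply_mid, x0_inv_apply_right, x1_inv_apply_right, x0_apply_right]
    linarith
  | succ K ih =>
    obtain ⟨m, rfl⟩ : ∃ m', m = m' + 1 := ⟨m - 1, by omega⟩
    have hy : (0 : ℝ) < (1 / 4) ^ K := by positivity
    have hy1 : ((1 : ℝ) / 4) ^ K ≤ 1 := pow_le_one₀ (by norm_num) (by norm_num)
    rw [pow_succ] at h₀ h₁ ⊢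
    rw [fEl_apply_scale (m + 1) (w := 4 * v / 4 + 5 / 32 * (1 / 4) ^ K) (by linarith)
      (by linarith) (by linarith) (by linarith)
      (ih m (by omega) (by linarith) (by linarith))]
    linarith

lemma gEl_apply_expanding (m K : ℕ) (hK : K ≤ m) {v : ℝ} (h₀ : 3 / 8 * (1 / 8) ^ K ≤ v)
    (h₁ : v ≤ 1 / 2 * (1 / 8) ^ K) :
    gEl (m + 2) (1 - v) = 1 - (4 * v - 5 / 4 * (1 / 8) ^ K) := by
  induction K generalizing m v with
  | zero =>
    simp only [pow_zero, mul_one] at h₀ h₁ ⊢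
    rw [gEl_two_add]
    rcases le_total v (7 / 16) with hv | hv
    · simp (disch := grind) only [Equiv.Perm.mul_apply, x1_inv_apply_mid, x0_apply_mid,
        x1_apply_left, x0_apply_left, gEl_apply_left, x0_inv_apply_left, x0_inv_apply_mid,
        x1_inv_apply_mid', x0_apply_right]
      linarith
    · simp (disch := grind) only [Equiv.Perm.mul_apply, x1_inv_apply_mid, x0_apply_mid,
        x1_apply_left, x0_apply_left, gEl_apply_left, x0_inv_apply_left, x0_inv_apply_mid]
      linarith
  | succ K ih =>
    obtain ⟨m, rfl⟩ : ∃ m', m = m' + 1 := ⟨m - 1, by omega⟩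
    have hy : (0 : ℝ) < (1 / 8) ^ K := by positivity
    have hy1 : ((1 : ℝ) / 8) ^ K ≤ 1 := pow_le_one₀ (by norm_num) (by norm_num)
    rw [pow_succ] at h₀ h₁ ⊢
    rw [gEl_apply_scale (m + 1) (w := 4 * (8 * v) - 5 / 4 * (1 / 8) ^ K) (by linarith)
      (by linarith) (by linarith) (by linarith)
      (ih m (by omega) (by linarith) (by linarith))]
    linarith

lemma gEl_apply_translating (m K : ℕ) (hK : K ≤ m) {v : ℝ} (h₀ : 1 / 4 * (1 / 8) ^ K ≤ v)
    (h₁ : v ≤ 3 / 8 * (1 / 8) ^ K) :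
    gEl (m + 2) (1 - v) = 1 - (v - 1 / 8 * (1 / 8) ^ K) := by
  induction K generalizing m v with
  | zero =>
    simp only [pow_zero, mul_one] at h₀ h₁ ⊢
    rw [gEl_two_add]
    simp (disch := grind) only [Equiv.Perm.mul_apply, x0_apply_mid,
      x1_apply_left, x0_apply_left, gEl_apply_left, x0_inv_apply_left, x0_inv_apply_mid,
      x1_inv_apply_mid', x1_inv_apply_right, x0_apply_right]
    linarith
  | succ K ih =>
    obtain ⟨m, rfl⟩ : ∃ m', m = m' + 1 := ⟨m - 1, by omega⟩
    have hy : (0 : ℝ) < (1 / 8) ^ K := by positivity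
    have hy1 : ((1 : ℝ) / 8) ^ K ≤ 1 := pow_le_one₀ (by norm_num) (by norm_num)
    rw [pow_succ] at h₀ h₁ ⊢
    rw [gEl_apply_scale (m + 1) (w := 8 * v - 1 / 8 * (1 / 8) ^ K) (by linarith)
      (by linarith) (by linarith) (by linarith)
      (ih m (by omega) (by linarith) (by linarith))]
    linarith

lemma gEl_apply_contracting_left (m K : ℕ) (hK : K ≤ m) {v : ℝ}
    (h₀ : 1 / 8 * (1 / 8) ^ K ≤ v) (h₁ : v ≤ 1 / 4 * (1 / 8) ^ K) :
    gEl (m + 2) (1 - v) = 1 - (v / 8 + 3 / 32 * (1 / 8) ^ K) := by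
  induction K generalizing m v with
  | zero =>
    simp only [pow_zero, mul_one] at h₀ h₁ ⊢
    rw [gEl_two_add]
    simp (disch := grind) only [Equiv.Perm.mul_apply, x0_apply_mid,
      x1_apply_mid, gEl_apply_left, x0_inv_apply_left, x0_inv_apply_mid, x0_inv_apply_right,
      x1_inv_apply_right, x0_apply_right]
    linarith
  | succ K ih =>
    obtain ⟨m, rfl⟩ : ∃ m', m = m' + 1 := ⟨m - 1, by omega⟩
    have hy : (0 : ℝ) < (1 / 8) ^ K := by positivity
    have hy1 : ((1 : ℝ) / 8) ^ K ≤ 1 := pow_le_one₀ (by norm_num) (by norm_num)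
    rw [pow_succ] at h₀ h₁ ⊢
    rw [gEl_apply_scale (m + 1) (w := 8 * v / 8 + 3 / 32 * (1 / 8) ^ K) (by linarith)
      (by linarith) (by linarith) (by linarith)
      (ih m (by omega) (by linarith) (by linarith))]
    linarith

lemma gEl_apply_contracting_right (m K : ℕ) (hK : K ≤ m) {v : ℝ}
    (h₀ : 1 / 16 * (1 / 8) ^ K ≤ v) (h₁ : v ≤ 1 / 8 * (1 / 8) ^ K) :
    gEl (m + 2) (1 - v) = 1 - (v / 4 + 5 / 64 * (1 / 8) ^ K) := by
  induction K generalizing m v with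
  | zero =>
    simp only [pow_zero, mul_one] at h₀ h₁ ⊢
    rw [gEl_two_add]
    simp (disch := grind) only [Equiv.Perm.mul_apply, x0_apply_mid,
      x1_apply_mid, x1_apply_mid', gEl_apply_left, x0_inv_apply_left, x0_inv_apply_mid,
      x0_inv_apply_right, x1_inv_apply_right, x0_apply_right]
    linarith
  | succ K ih =>
    obtain ⟨m, rfl⟩ : ∃ m', m = m' + 1 := ⟨m - 1, by omega⟩
    have hy : (0 : ℝ) < (1 / 8) ^ K := by positivity
    have hy1 : ((1 : ℝ) / 8) ^ K ≤ 1 := pow_le_one₀ (by norm_num) (by norm_num)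
    rw [pow_succ] at h₀ h₁ ⊢
    rw [gEl_apply_scale (m + 1) (w := 8 * v / 4 + 5 / 64 * (1 / 8) ^ K) (by linarith)
      (by linarith) (by linarith) (by linarith)
      (ih m (by omega) (by linarith) (by linarith))]
    linarith

/-! ### Logarithmic slopes of elements of `F` -/

/-- The ring `ℤ[1/2]` of dyadic rationals. -/
def dyadics : Subring ℝ := Subring.closure {1 / 2}

lemma half_mem_dyadics : (1 / 2 : ℝ) ∈ dyadics := Subring.subset_closure rfl

lemma div_two_mem_dyadics {t : ℝ} (ht : t ∈ dyadics) : t / 2 ∈ dyadics := by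
  simpa [div_eq_mul_inv] using mul_mem ht half_mem_dyadics

lemma exists_mul_two_pow_of_mem_dyadics {t : ℝ} (ht : t ∈ dyadics) :
    ∃ (m : ℕ) (z : ℤ), t * 2 ^ m = z := by
  induction ht using Subring.closure_induction with
  | mem x hx => exact ⟨1, 1, by rw [Set.mem_singleton_iff.1 hx]; norm_num⟩
  | zero => exact ⟨0, 0, by simp⟩
  | one => exact ⟨0, 1, by simp⟩
  | neg x _ hx =>
    obtain ⟨m, z, h⟩ := hx
    exact ⟨m, -z, by push_cast; linarith⟩
  | add x y _ _ hx hy =>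
    obtain ⟨m, z, h⟩ := hx
    obtain ⟨k, w, h'⟩ := hy
    exact ⟨m + k, z * 2 ^ k + w * 2 ^ m, by push_cast; rw [← h, ← h']; ring⟩
  | mul x y _ _ hx hy =>
    obtain ⟨m, z, h⟩ := hx
    obtain ⟨k, w, h'⟩ := hy
    exact ⟨m + k, z * w, by push_cast; rw [← h, ← h']; ring⟩

lemma five_thirds_not_mem_dyadics : (5 / 3 : ℝ) ∉ dyadics := by
  intro h
  obtain ⟨m, z, hz⟩ := exists_mul_two_pow_of_mem_dyadics h
  have h1 : (5 * 2 ^ m : ℤ) = 3 * z := by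
    have : (5 * 2 ^ m : ℝ) = 3 * z := by linarith
    exact_mod_cast this
  have h2 : (3 : ℤ) ∣ 5 * 2 ^ m := ⟨z, h1⟩
  rcases Int.prime_three.dvd_or_dvd h2 with h3 | h3
  · norm_num at h3
  · have := Int.prime_three.dvd_of_dvd_pow h3
    norm_num at this

/-- The indicator function of `[c, ∞)`. -/
def unitStep (c t : ℝ) : ℤ := if c ≤ t then 1 else 0

lemma sum_abs_unitStep_le (c : ℝ) {u : ℕ → ℝ} (hu : Monotone u) (N : ℕ) :
    ∑ i ∈ Finset.range N, |unitStep c (u (i + 1)) - unitStep c (u i)| ≤ 1 := by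
  have hmono : ∀ i, unitStep c (u i) ≤ unitStep c (u (i + 1)) := by
    intro i
    have := hu (Nat.le_succ i)
    unfold unitStep
    split_ifs with h1 h2 h2
    · exact le_rfl
    · exact absurd (h1.trans this) h2
    · exact zero_le_one
    · exact le_rfl
  rw [Finset.sum_congr rfl fun i _ => abs_of_nonneg (sub_nonneg.2 (hmono i)),
    Finset.sum_range_sub fun i => unitStep c (u i)]
  unfold unitStep
  split_ifs <;> norm_num

/-- `D` is a logarithmic slope function of the homeomorphism `h` of `[0,1]` away from the dyadic
rationals, of total variation at most `3 * l`. -/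
structure IsLogSlope (h : Equiv.Perm ℝ) (D : ℝ → ℤ) (l : ℕ) : Prop where
  strictMono : StrictMono h
  map_zero : h 0 = 0
  map_one : h 1 = 1
  not_dyadic : ∀ t, t ∉ dyadics → h t ∉ dyadics
  linear : ∀ t, t ∉ dyadics → 0 < t → t < 1 →
    ∃ δ > 0, ∀ x, |x| ≤ δ → h (t + x) = h t + 2 ^ D t * x
  variation : ∀ u : ℕ → ℝ, Monotone u → ∀ N,
    ∑ i ∈ Finset.range N, |D (u (i + 1)) - D (u i)| ≤ 3 * l

lemma IsLogSlope.one : IsLogSlope 1 (fun _ => 0) 0 where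
  strictMono := strictMono_id
  map_zero := rfl
  map_one := rfl
  not_dyadic _ ht := ht
  linear t _ _ _ := ⟨1, one_pos, fun x _ => by simp⟩
  variation u _ N := by simp

lemma IsLogSlope.mul {h k : Equiv.Perm ℝ} {D E : ℝ → ℤ} {l r : ℕ} (hh : IsLogSlope h D l)
    (hk : IsLogSlope k E r) : IsLogSlope (h * k) (fun t => D (k t) + E t) (l + r) where
  strictMono := hh.strictMono.comp hk.strictMono
  map_zero := by rw [Equiv.Perm.mul_apply, hk.map_zero, hh.map_zero]
  map_one := by rw [Equiv.Perm.mul_apply, hk.map_one, hh.map_one]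
  not_dyadic t ht := hh.not_dyadic _ (hk.not_dyadic _ ht)
  linear t ht ht0 ht1 := by
    obtain ⟨δ, hδ, hx⟩ := hh.linear (k t) (hk.not_dyadic t ht)
      (by simpa [hk.map_zero] using hk.strictMono ht0)
      (by simpa [hk.map_one] using hk.strictMono ht1)
    obtain ⟨ε, hε, hy⟩ := hk.linear t ht ht0 ht1
    have h2 : (0 : ℝ) < 2 ^ E t := by positivity
    refine ⟨min ε (δ / 2 ^ E t), by positivity, fun x hx' => ?_⟩
    rw [le_min_iff, le_div_iff₀ h2] at hx'
    rw [Equiv.Perm.mul_apply, Equiv.Perm.mul_apply, hy x hx'.1, hx, zpow_add₀ two_ne_zero]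
    · ring
    · rw [abs_mul, abs_of_pos h2, mul_comm]
      exact hx'.2
  variation u hu N := by
    have h1 := hh.variation (fun i => k (u i)) (hk.strictMono.monotone.comp hu) N
    have h2 := hk.variation u hu N
    calc ∑ i ∈ Finset.range N, |D (k (u (i + 1))) + E (u (i + 1)) - (D (k (u i)) + E (u i))|
        ≤ ∑ i ∈ Finset.range N, (|D (k (u (i + 1))) - D (k (u i))| + |E (u (i + 1)) - E (u i)|) :=
          Finset.sum_le_sum fun i _ => by rw [add_sub_add_comm]; exact abs_add_le _ _
      _ ≤ 3 * ((l + r : ℕ) : ℤ) := by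
          rw [Finset.sum_add_distrib]
          push_cast
          linarith

lemma sum_abs_threeStep_le (z e₁ e₂ e₃ : ℤ) (c₁ c₂ c₃ : ℝ) (h₁ : |e₁| ≤ 1) (h₂ : |e₂| ≤ 1)
    (h₃ : |e₃| ≤ 1) {u : ℕ → ℝ} (hu : Monotone u) (N : ℕ) :
    ∑ i ∈ Finset.range N,
      |(z + e₁ * unitStep c₁ (u (i + 1)) + e₂ * unitStep c₂ (u (i + 1)) +
          e₃ * unitStep c₃ (u (i + 1))) -
        (z + e₁ * unitStep c₁ (u i) + e₂ * unitStep c₂ (u i) + e₃ * unitStep c₃ (u i))| ≤ 3 := by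
  have key : ∀ i, |(z + e₁ * unitStep c₁ (u (i + 1)) + e₂ * unitStep c₂ (u (i + 1)) +
          e₃ * unitStep c₃ (u (i + 1))) -
        (z + e₁ * unitStep c₁ (u i) + e₂ * unitStep c₂ (u i) + e₃ * unitStep c₃ (u i))| ≤
      |unitStep c₁ (u (i + 1)) - unitStep c₁ (u i)| +
        |unitStep c₂ (u (i + 1)) - unitStep c₂ (u i)| +
        |unitStep c₃ (u (i + 1)) - unitStep c₃ (u i)| := by
    intro i
    have hmul : ∀ e x : ℤ, |e| ≤ 1 → |e * x| ≤ |x| := fun e x he => by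
      rw [abs_mul]
      exact mul_le_of_le_one_left (abs_nonneg x) he
    calc _ = |e₁ * (unitStep c₁ (u (i + 1)) - unitStep c₁ (u i)) +
          e₂ * (unitStep c₂ (u (i + 1)) - unitStep c₂ (u i)) +
          e₃ * (unitStep c₃ (u (i + 1)) - unitStep c₃ (u i))| := by congr 1; ring
      _ ≤ _ := (abs_add_three _ _ _).trans
          (add_le_add_three (hmul _ _ h₁) (hmul _ _ h₂) (hmul _ _ h₃))
  refine (Finset.sum_le_sum fun i _ => key i).trans ?_
  rw [Finset.sum_add_distrib, Finset.sum_add_distrib]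
  linarith [sum_abs_unitStep_le c₁ hu N, sum_abs_unitStep_le c₂ hu N,
    sum_abs_unitStep_le c₃ hu N]

lemma exists_linear_of_affine_on_Icc {h : ℝ → ℝ} {a b e t : ℝ} {k : ℤ} (hat : a < t) (htb : t < b)
    (H : ∀ y, a ≤ y → y ≤ b → h y = 2 ^ k * y + e) :
    ∃ δ > 0, ∀ x, |x| ≤ δ → h (t + x) = h t + 2 ^ k * x := by
  refine ⟨min (t - a) (b - t), lt_min (by linarith) (by linarith), fun x hx => ?_⟩
  rw [le_min_iff] at hx
  have := abs_le.1 hx.1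
  have := abs_le.1 hx.2
  rw [H _ (by linarith) (by linarith), H t hat.le htb.le]
  ring

lemma strictMono_x0 : StrictMono x0 := by
  intro a b hab
  change x0fun a < x0fun b
  unfold x0fun
  split_ifs <;> linarith

lemma strictMono_x1 : StrictMono x1 := by
  intro a b hab
  change x1fun a < x1fun b
  unfold x1fun
  split_ifs <;> linarith

lemma strictMono_inv {s : Equiv.Perm ℝ} (hs : StrictMono s) : StrictMono (s⁻¹ : Equiv.Perm ℝ) := by
  intro a b hab
  rw [← hs.lt_iff_lt]
  simpa using hab

lemma fourth_mem_dyadics : (1 / 4 : ℝ) ∈ dyadics := by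
  convert div_two_mem_dyadics half_mem_dyadics using 1; norm_num

lemma eighth_mem_dyadics : (1 / 8 : ℝ) ∈ dyadics := by
  convert div_two_mem_dyadics fourth_mem_dyadics using 1; norm_num

lemma x0_mem_dyadics {t : ℝ} (ht : t ∈ dyadics) : x0 t ∈ dyadics := by
  have h2 := half_mem_dyadics
  have h4 := fourth_mem_dyadics
  change x0fun t ∈ _
  unfold x0fun
  split_ifs <;> repeat first
    | assumption | exact one_mem _ | exact ofNat_mem _ 2 | apply sub_mem | apply add_mem
    | apply div_two_mem_dyadics | apply mul_mem

lemma x0_inv_mem_dyadics {t : ℝ} (ht : t ∈ dyadics) : x0⁻¹ t ∈ dyadics := by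
  have h2 := half_mem_dyadics
  have h4 := fourth_mem_dyadics
  change x0inv t ∈ _
  unfold x0inv
  split_ifs <;> repeat first
    | assumption | exact one_mem _ | exact ofNat_mem _ 2 | apply sub_mem | apply add_mem
    | apply div_two_mem_dyadics | apply mul_mem

lemma x1_mem_dyadics {t : ℝ} (ht : t ∈ dyadics) : x1 t ∈ dyadics := by
  have h2 := half_mem_dyadics
  have h4 := fourth_mem_dyadics
  have h8 := eighth_mem_dyadics
  change x1fun t ∈ _
  unfold x1fun
  split_ifs <;> repeat first
    | assumption | exact one_mem _ | exact ofNat_mem _ 2 | apply sub_mem | apply add_mem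
    | apply div_two_mem_dyadics | apply mul_mem

lemma x1_inv_mem_dyadics {t : ℝ} (ht : t ∈ dyadics) : x1⁻¹ t ∈ dyadics := by
  have h2 := half_mem_dyadics
  have h4 := fourth_mem_dyadics
  have h8 := eighth_mem_dyadics
  change x1inv t ∈ _
  unfold x1inv
  split_ifs <;> repeat first
    | assumption | exact one_mem _ | exact ofNat_mem _ 2 | apply sub_mem | apply add_mem
    | apply div_two_mem_dyadics | apply mul_mem

lemma ne_of_not_mem_dyadics {t c : ℝ} (ht : t ∉ dyadics) (z : ℕ) (hc : c = z * (1 / 8)) :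
    t ≠ c := by
  rintro rfl
  exact ht (hc ▸ mul_mem (natCast_mem _ z) eighth_mem_dyadics)

lemma isLogSlope_x0 : IsLogSlope x0
    (fun t => -1 + 1 * unitStep (1 / 2) t + 1 * unitStep (3 / 4) t + 0 * unitStep 0 t) 1 where
  strictMono := strictMono_x0
  map_zero := by rw [x0_apply_left] <;> norm_num
  map_one := by rw [x0_apply_right] <;> norm_num
  not_dyadic t ht h := ht (by simpa using x0_inv_mem_dyadics h)
  linear t ht ht0 ht1 := by
    rcases (ne_of_not_mem_dyadics ht (c := 1 / 2) 4 (by norm_num)).lt_or_gt with h | h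
    · refine exists_linear_of_affine_on_Icc (e := 0) ht0 h fun y h₀ h₁ => ?_
      rw [x0_apply_left h₀ h₁]
      rw [unitStep, unitStep, if_neg (by linarith), if_neg (by linarith)]
      norm_num
      ring
    rcases (ne_of_not_mem_dyadics ht (c := 3 / 4) 6 (by norm_num)).lt_or_gt with h' | h'
    · refine exists_linear_of_affine_on_Icc (e := -(1 / 4)) h h' fun y h₀ h₁ => ?_
      rw [x0_apply_mid h₀ h₁]
      rw [unitStep, unitStep, if_pos (by linarith), if_neg (by linarith)]
      norm_num
      ring
    · refine exists_linear_of_affine_on_Icc (e := -1) h' ht1 fun y h₀ h₁ => ?_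
      rw [x0_apply_right h₀ h₁]
      rw [unitStep, unitStep, if_pos (by linarith), if_pos (by linarith)]
      norm_num
      ring
  variation u hu N :=
    sum_abs_threeStep_le _ _ _ _ _ _ _ (by norm_num) (by norm_num) (by norm_num) hu N

lemma isLogSlope_x0_inv : IsLogSlope x0⁻¹
    (fun t => 1 + (-1) * unitStep (1 / 4) t + (-1) * unitStep (1 / 2) t + 0 * unitStep 0 t) 1 where
  strictMono := strictMono_inv strictMono_x0
  map_zero := by rw [x0_inv_apply_left] <;> norm_num
  map_one := by rw [x0_inv_apply_right] <;> norm_num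
  not_dyadic t ht h := ht (by simpa using x0_mem_dyadics h)
  linear t ht ht0 ht1 := by
    rcases (ne_of_not_mem_dyadics ht (c := 1 / 4) 2 (by norm_num)).lt_or_gt with h | h
    · refine exists_linear_of_affine_on_Icc (e := 0) ht0 h fun y h₀ h₁ => ?_
      rw [x0_inv_apply_left h₀ h₁]
      rw [unitStep, unitStep, if_neg (by linarith), if_neg (by linarith)]
      norm_num
    rcases (ne_of_not_mem_dyadics ht (c := 1 / 2) 4 (by norm_num)).lt_or_gt with h' | h'
    · refine exists_linear_of_affine_on_Icc (e := 1 / 4) h h' fun y h₀ h₁ => ?_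
      rw [x0_inv_apply_mid h₀ h₁]
      rw [unitStep, unitStep, if_pos (by linarith), if_neg (by linarith)]
      norm_num
    · refine exists_linear_of_affine_on_Icc (e := 1 / 2) h' ht1 fun y h₀ h₁ => ?_
      rw [x0_inv_apply_right h₀ h₁]
      rw [unitStep, unitStep, if_pos (by linarith), if_pos (by linarith)]
      norm_num
      ring
  variation u hu N :=
    sum_abs_threeStep_le _ _ _ _ _ _ _ (by norm_num) (by norm_num) (by norm_num) hu N

lemma isLogSlope_x1 : IsLogSlope x1
    (fun t => 0 + (-1) * unitStep (1 / 2) t + 1 * unitStep (3 / 4) t + 1 * unitStep (7 / 8) t)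
    1 where
  strictMono := strictMono_x1
  map_zero := by rw [x1_apply_left] <;> norm_num
  map_one := by rw [x1_apply_right] <;> norm_num
  not_dyadic t ht h := ht (by simpa using x1_inv_mem_dyadics h)
  linear t ht ht0 ht1 := by
    rcases (ne_of_not_mem_dyadics ht (c := 1 / 2) 4 (by norm_num)).lt_or_gt with h | h
    · refine exists_linear_of_affine_on_Icc (e := 0) ht0 h fun y h₀ h₁ => ?_
      rw [x1_apply_left h₀ h₁]
      rw [unitStep, unitStep, unitStep, if_neg (by linarith), if_neg (by linarith),
        if_neg (by linarith)]
      norm_num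
    rcases (ne_of_not_mem_dyadics ht (c := 3 / 4) 6 (by norm_num)).lt_or_gt with h' | h'
    · refine exists_linear_of_affine_on_Icc (e := 1 / 4) h h' fun y h₀ h₁ => ?_
      rw [x1_apply_mid h₀ h₁]
      rw [unitStep, unitStep, unitStep, if_pos (by linarith), if_neg (by linarith),
        if_neg (by linarith)]
      norm_num
      ring
    rcases (ne_of_not_mem_dyadics ht (c := 7 / 8) 7 (by norm_num)).lt_or_gt with h'' | h''
    · refine exists_linear_of_affine_on_Icc (e := -(1 / 8)) h' h'' fun y h₀ h₁ => ?_
      rw [x1_apply_mid' h₀ h₁]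
      rw [unitStep, unitStep, unitStep, if_pos (by linarith), if_pos (by linarith),
        if_neg (by linarith)]
      norm_num
      ring
    · refine exists_linear_of_affine_on_Icc (e := -1) h'' ht1 fun y h₀ h₁ => ?_
      rw [x1_apply_right h₀ h₁]
      rw [unitStep, unitStep, unitStep, if_pos (by linarith), if_pos (by linarith),
        if_pos (by linarith)]
      norm_num
      ring
  variation u hu N :=
    sum_abs_threeStep_le _ _ _ _ _ _ _ (by norm_num) (by norm_num) (by norm_num) hu N

lemma isLogSlope_x1_inv : IsLogSlope x1⁻¹
    (fun t => 0 + 1 * unitStep (1 / 2) t + (-1) * unitStep (5 / 8) t + (-1) * unitStep (3 / 4) t)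
    1 where
  strictMono := strictMono_inv strictMono_x1
  map_zero := by rw [x1_inv_apply_left] <;> norm_num
  map_one := by rw [x1_inv_apply_right] <;> norm_num
  not_dyadic t ht h := ht (by simpa using x1_mem_dyadics h)
  linear t ht ht0 ht1 := by
    rcases (ne_of_not_mem_dyadics ht (c := 1 / 2) 4 (by norm_num)).lt_or_gt with h | h
    · refine exists_linear_of_affine_on_Icc (e := 0) ht0 h fun y h₀ h₁ => ?_
      rw [x1_inv_apply_left h₀ h₁]
      rw [unitStep, unitStep, unitStep, if_neg (by linarith), if_neg (by linarith),
        if_neg (by linarith)]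
      norm_num
    rcases (ne_of_not_mem_dyadics ht (c := 5 / 8) 5 (by norm_num)).lt_or_gt with h' | h'
    · refine exists_linear_of_affine_on_Icc (e := -(1 / 2)) h h' fun y h₀ h₁ => ?_
      rw [x1_inv_apply_mid h₀ h₁]
      rw [unitStep, unitStep, unitStep, if_pos (by linarith), if_neg (by linarith),
        if_neg (by linarith)]
      norm_num
      ring
    rcases (ne_of_not_mem_dyadics ht (c := 3 / 4) 6 (by norm_num)).lt_or_gt with h'' | h''
    · refine exists_linear_of_affine_on_Icc (e := 1 / 8) h' h'' fun y h₀ h₁ => ?_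
      rw [x1_inv_apply_mid' h₀ h₁]
      rw [unitStep, unitStep, unitStep, if_pos (by linarith), if_pos (by linarith),
        if_neg (by linarith)]
      norm_num
    · refine exists_linear_of_affine_on_Icc (e := 1 / 2) h'' ht1 fun y h₀ h₁ => ?_
      rw [x1_inv_apply_right h₀ h₁]
      rw [unitStep, unitStep, unitStep, if_pos (by linarith), if_pos (by linarith),
        if_pos (by linarith)]
      norm_num
      ring
  variation u hu N :=
    sum_abs_threeStep_le _ _ _ _ _ _ _ (by norm_num) (by norm_num) (by norm_num) hu N

lemma exists_isLogSlope_list_prod (w : List (Equiv.Perm ℝ))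
    (hw : ∀ g ∈ w, g ∈ ({x0, x1, x0⁻¹, x1⁻¹} : Set (Equiv.Perm ℝ))) :
    ∃ D, IsLogSlope w.prod D w.length := by
  induction w with
  | nil => exact ⟨_, IsLogSlope.one⟩
  | cons s w ih =>
    obtain ⟨D, hD⟩ := ih fun g hg => hw g (List.mem_cons_of_mem _ hg)
    have hs : ∃ E, IsLogSlope s E 1 := by
      have := hw s List.mem_cons_self
      simp only [Set.mem_insert_iff, Set.mem_singleton_iff] at this
      rcases this with rfl | rfl | rfl | rfl
      exacts [⟨_, isLogSlope_x0⟩, ⟨_, isLogSlope_x1⟩, ⟨_, isLogSlope_x0_inv⟩,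
        ⟨_, isLogSlope_x1_inv⟩]
    obtain ⟨E, hE⟩ := hs
    rw [List.prod_cons, List.length_cons, add_comm]
    exact ⟨_, hE.mul hD⟩

lemma exists_isLogSlope_wordLength {h : Equiv.Perm ℝ} (hh : h ∈ ThompsonF) :
    ∃ D, IsLogSlope h D (wordLength h) := by
  have hne : {n | ∃ w : List (Equiv.Perm ℝ), w.length = n ∧
      (∀ g ∈ w, g ∈ ({x0, x1, x0⁻¹, x1⁻¹} : Set (Equiv.Perm ℝ))) ∧ w.prod = h}.Nonempty := by
    have hh' : h ∈ Submonoid.closure ({x0, x1} ∪ ({x0, x1} : Set (Equiv.Perm ℝ))⁻¹) := by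
      rw [← Subgroup.closure_toSubmonoid]
      exact hh
    obtain ⟨w, hw, hprod⟩ := Submonoid.exists_list_of_mem_closure hh'
    refine ⟨w.length, w, rfl, fun g hg => ?_, hprod⟩
    have := hw g hg
    simp at this ⊢
    tauto
  obtain ⟨w, hlen, hw, rfl⟩ := Nat.sInf_mem hne
  obtain ⟨D, hD⟩ := exists_isLogSlope_list_prod w hw
  exact ⟨D, by rw [hlen] at hD; exact hD⟩

/-! ### Conjugacy between consecutive fixed points -/

lemma iterate_expanding {F : ℝ → ℝ} {P a : ℝ}
    (hF : ∀ s, 0 ≤ s → s ≤ 1 → F (P + s * a) = P + 4 * s * a) (p : ℕ) {s : ℝ} (h₀ : 0 ≤ s)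
    (h₁ : s ≤ 1) : F^[p] (P + s / 4 ^ p * a) = P + s * a := by
  induction p with
  | zero => simp
  | succ p ih =>
    have h4 : (1 : ℝ) ≤ 4 ^ (p + 1) := one_le_pow₀ (by norm_num)
    rw [Function.iterate_succ_apply, hF _ (by positivity) (div_le_one_of_le₀ (by linarith)
      (by positivity)), ← ih]
    congr 3
    rw [pow_succ]
    field_simp

lemma iterate_contracting {F : ℝ → ℝ} {Q a R : ℝ}
    (hF : ∀ r, 0 ≤ r → r ≤ R → F (Q - r * a) = Q - r / 4 * a) (q : ℕ) {r : ℝ} (h₀ : 0 ≤ r)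
    (h₁ : r ≤ R) : F^[q] (Q - r * a) = Q - r / 4 ^ q * a := by
  induction q with
  | zero => simp
  | succ q ih =>
    have h4 : (1 : ℝ) ≤ 4 ^ q := one_le_pow₀ (by norm_num)
    rw [Function.iterate_succ_apply', ih, hF _ (by positivity)
      ((div_le_self h₀ h4).trans h₁), pow_succ, div_div]

lemma exists_pow_scale_le {δ : ℝ} (hδ : 0 < δ) (a : ℝ) :
    ∃ i₀ : ℕ, ∀ i ≥ i₀, |1 / 4 ^ i * a| ≤ δ := by
  have h := (tendsto_pow_atTop_nhds_zero_of_lt_one (r := (1 / 4 : ℝ)) (by norm_num)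
    (by norm_num)).mul_const a
  rw [zero_mul] at h
  obtain ⟨i₀, hi⟩ := Metric.tendsto_atTop.1 h δ hδ
  refine ⟨i₀, fun i hi' => ?_⟩
  have := hi i hi'
  rw [Real.dist_eq, sub_zero, one_div_pow] at this
  exact this.le

lemma two_zpow_ne_three (z : ℤ) : (2 : ℝ) ^ z ≠ 3 := by
  intro h
  rcases le_or_gt z 1 with hz | hz
  · have := zpow_le_zpow_right₀ (one_le_two (α := ℝ)) hz
    norm_num [h] at this
  · have := zpow_le_zpow_right₀ (one_le_two (α := ℝ)) (show (2 : ℤ) ≤ z by omega)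
    rw [h] at this
    norm_num at this

section Transit

variable {F G H : ℝ → ℝ} {P Q a P' Q' b ν : ℝ} {c : ℕ} {α β A B : ℤ}

/-- Compare the orbit of a breakpoint of `G` running from a repelling to an attracting fixed point
with its image under the conjugator `H`. -/
lemma transit_scale (hH : Function.Semiconj H G F) (ha : a ≠ 0)
    (hFP : ∀ s, 0 ≤ s → s ≤ 1 → F (P + s * a) = P + 4 * s * a)
    (hFQ : ∀ r, 0 ≤ r → r ≤ 4 → F (Q - r * a) = Q - r / 4 * a) (hPQ : Q = P + 5 * a)
    (hGP : ∀ s, 0 ≤ s → s ≤ 1 → G (P' + s * b) = P' + 4 * s * b)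
    (hGQ : ∀ r, 0 ≤ r → r ≤ 1 → G (Q' - r * (ν * b)) = Q' - r / 4 * (ν * b))
    (hGc : G^[c] (P' + b) = Q' - ν * b)
    (hHP : ∃ δ > 0, ∀ x, |x| ≤ δ → H (P' + x) = P + 2 ^ α * x)
    (hHQ : ∃ δ > 0, ∀ x, |x| ≤ δ → H (Q' + x) = Q + 2 ^ β * x)
    (hA : 2 ^ α * b = 2 ^ A * a) (hB : 2 ^ β * (ν * b) = 2 ^ B * a)
    {e : ℤ} {s : ℝ} (hs : 1 / 4 ≤ s) (hs' : s ≤ 1) (hAe : (2 : ℝ) ^ A = 4 ^ e * s) :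
    (2 : ℝ) ^ B = (5 - 4 * s) * 4 ^ (1 - c - e : ℤ) := by
  obtain ⟨δ, hδ, hP⟩ := hHP
  obtain ⟨ε, hε, hQ⟩ := hHQ
  obtain ⟨i₀, hi₀⟩ := exists_pow_scale_le hδ b
  obtain ⟨j₀, hj₀⟩ := exists_pow_scale_le hε (-(ν * b))
  obtain ⟨i, hi, hie⟩ : ∃ i : ℕ, i₀ ≤ i ∧ e ≤ i := ⟨i₀ + e.toNat, by omega, by omega⟩
  obtain ⟨j, hj, hje⟩ : ∃ j : ℕ, j₀ ≤ j ∧ 0 ≤ j + c + e - 1 :=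
    ⟨j₀ + (-e).toNat + 1, by omega, by omega⟩
  obtain ⟨p, hp⟩ : ∃ p : ℕ, (p : ℤ) = i - e := ⟨(i - e).toNat, by omega⟩
  obtain ⟨q, hq⟩ : ∃ q : ℕ, (q : ℤ) = j + c + e - 1 := ⟨(j + c + e - 1).toNat, by omega⟩
  have hN : q + (1 + p) = j + (c + i) := by omega
  have h4 : (4 : ℝ) ≠ 0 := by norm_num
  have hG : G^[j + (c + i)] (P' + 1 / 4 ^ i * b) = Q' - 1 / 4 ^ j * (ν * b) := by
    rw [Function.iterate_add_apply, Function.iterate_add_apply,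
      iterate_expanding hGP i zero_le_one le_rfl, one_mul, hGc]
    simpa using iterate_contracting hGQ j zero_le_one le_rfl
  have hstart : H (P' + 1 / 4 ^ i * b) = P + s / 4 ^ p * a := by
    rw [hP _ (hi₀ i hi)]
    have hpe : (4 : ℝ) ^ i = 4 ^ p * 4 ^ e := by
      rw [← zpow_natCast, ← zpow_natCast, ← zpow_add₀ h4]
      congr 1
      omega
    have : (2 : ℝ) ^ α * (1 / 4 ^ i * b) = 1 / 4 ^ i * (2 ^ A * a) := by rw [← hA]; ring
    rw [this, hAe, hpe]
    field_simp
  have hF : F^[q + (1 + p)] (P + s / 4 ^ p * a) = Q - (5 - 4 * s) / 4 ^ q * a := by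
    rw [Function.iterate_add_apply, Function.iterate_add_apply,
      iterate_expanding hFP p (by linarith) hs', Function.iterate_one,
      hFP s (by linarith) hs', show P + 4 * s * a = Q - (5 - 4 * s) * a by rw [hPQ]; ring]
    exact iterate_contracting hFQ q (by linarith) (by linarith)
  have hend : H (Q' - 1 / 4 ^ j * (ν * b)) = Q - 2 ^ B / 4 ^ j * a := by
    have := hQ _ (hj₀ j hj)
    rw [show Q' + 1 / 4 ^ j * -(ν * b) = Q' - 1 / 4 ^ j * (ν * b) by ring] at this
    rw [this, show (2 : ℝ) ^ B / 4 ^ j * a = 1 / 4 ^ j * (2 ^ B * a) by ring, ← hB]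
    ring
  have key := (hH.iterate_right (j + (c + i))) (P' + 1 / 4 ^ i * b)
  rw [hG, hstart, hend, ← hN, hF, sub_right_inj, mul_left_inj' ha,
    div_eq_div_iff (by positivity) (by positivity)] at key
  have hqj : (4 : ℝ) ^ j = 4 ^ q * 4 ^ (1 - c - e : ℤ) := by
    rw [← zpow_natCast, ← zpow_natCast, ← zpow_add₀ h4]
    congr 1
    omega
  have hq0 : (4 : ℝ) ^ q ≠ 0 := by positivity
  apply mul_right_cancel₀ hq0
  rw [key, hqj]
  ring

lemma transit_exponents (hH : Function.Semiconj H G F) (ha : a ≠ 0)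
    (hFP : ∀ s, 0 ≤ s → s ≤ 1 → F (P + s * a) = P + 4 * s * a)
    (hFQ : ∀ r, 0 ≤ r → r ≤ 4 → F (Q - r * a) = Q - r / 4 * a) (hPQ : Q = P + 5 * a)
    (hGP : ∀ s, 0 ≤ s → s ≤ 1 → G (P' + s * b) = P' + 4 * s * b)
    (hGQ : ∀ r, 0 ≤ r → r ≤ 1 → G (Q' - r * (ν * b)) = Q' - r / 4 * (ν * b))
    (hGc : G^[c] (P' + b) = Q' - ν * b)
    (hHP : ∃ δ > 0, ∀ x, |x| ≤ δ → H (P' + x) = P + 2 ^ α * x)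
    (hHQ : ∃ δ > 0, ∀ x, |x| ≤ δ → H (Q' + x) = Q + 2 ^ β * x)
    (hA : 2 ^ α * b = 2 ^ A * a) (hB : 2 ^ β * (ν * b) = 2 ^ B * a) :
    A + B = 2 - 2 * c := by
  have h4 : ∀ e : ℤ, (4 : ℝ) ^ e = 2 ^ (2 * e) := fun e => by rw [zpow_mul]; norm_num
  rcases Int.even_or_odd' A with ⟨e, he | he⟩
  · have := transit_scale hH ha hFP hFQ hPQ hGP hGQ hGc hHP hHQ hA hB (e := e) (s := 1)
      (by norm_num) le_rfl (by rw [he, h4, mul_one])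
    rw [h4] at this
    norm_num at this
    omega
  · have := transit_scale hH ha hFP hFQ hPQ hGP hGQ hGc hHP hHQ hA hB (e := e + 1) (s := 1 / 2)
      (by norm_num) (by norm_num) (by
        rw [he, h4, show 2 * (e + 1) = 2 * e + 1 + 1 by ring, zpow_add_one₀ two_ne_zero (2 * e + 1)]
        ring)
    refine absurd ?_ (two_zpow_ne_three (B - 2 * (1 - c - (e + 1))))
    rw [zpow_sub₀ two_ne_zero, this, h4, div_eq_iff (by positivity)]
    norm_num

end Transit

lemma map_next_fixedPoint {F G : ℝ → ℝ} {H : Equiv.Perm ℝ} (hmono : StrictMono H)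
    (hH : Function.Semiconj H G F) {p q p' q' : ℝ} (hp : H p' = p) (hpq : p < q) (hpq' : p' < q')
    (hFq : F q = q) (hGq : G q' = q') (hF : ∀ t, p < t → t < q → F t ≠ t)
    (hG : ∀ t, p' < t → t < q' → G t ≠ t) : H q' = q := by
  refine le_antisymm ?_ ?_
  · by_contra! hlt
    obtain ⟨t, rfl⟩ := H.surjective q
    refine hG t ?_ (hmono.lt_iff_lt.1 hlt) (H.injective ((hH t).trans hFq))
    rw [← hmono.lt_iff_lt, hp]
    exact hpq
  · by_contra! hlt
    refine hF (H q') ?_ hlt ?_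
    · rw [← hp]
      exact hmono hpq'
    · rw [← hH q', hGq]

lemma sq_sub_one_le_sum_abs (M : ℕ) (c : ℤ) :
    (M : ℤ) ^ 2 - 1 ≤ ∑ K ∈ Finset.range M, |4 * (K : ℤ) + c| := by
  induction M using Nat.twoStepInduction generalizing c with
  | zero => simp
  | one => simp
  | more M ih _ =>
    have h := ih (c + 4)
    rw [Finset.sum_range_succ, Finset.sum_range_succ']
    have h1 : ∑ K ∈ Finset.range M, |4 * ((K + 1 : ℕ) : ℤ) + c| =
        ∑ K ∈ Finset.range M, |4 * (K : ℤ) + (c + 4)| :=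
      Finset.sum_congr rfl fun K _ => by congr 1; push_cast; ring
    rw [h1]
    have h2 := neg_abs_le (4 * ((0 : ℕ) : ℤ) + c)
    have h3 := le_abs_self (4 * ((M + 1 : ℕ) : ℤ) + c)
    push_cast at *
    nlinarith

lemma sum_range_two_mul (f : ℕ → ℤ) (M : ℕ) :
    ∑ i ∈ Finset.range (2 * M), f i =
      ∑ K ∈ Finset.range M, f (2 * K) + ∑ K ∈ Finset.range M, f (2 * K + 1) := by
  induction M with
  | zero => simp
  | succ M ih =>
    rw [show 2 * (M + 1) = 2 * M + 1 + 1 by ring, Finset.sum_range_succ, Finset.sum_range_succ, ih,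
      Finset.sum_range_succ, Finset.sum_range_succ]
    ring


/-! ### The conjugator -/

/-- The repelling fixed points of `fEl n` in `(0, 1)`. -/
def repF (K : ℕ) : ℝ := 1 - 5 / 12 * (1 / 4) ^ K

/-- The attracting fixed points of `fEl n` in `(0, 1)`. -/
def attF (K : ℕ) : ℝ := 1 - 5 / 24 * (1 / 4) ^ K

/-- The repelling fixed points of `gEl n` in `(0, 1)`. -/
def repG (K : ℕ) : ℝ := 1 - 5 / 12 * (1 / 8) ^ K

/-- The attracting fixed points of `gEl n` in `(0, 1)`. -/
def attG (K : ℕ) : ℝ := 1 - 5 / 48 * (1 / 8) ^ K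

lemma pow_quarter_pos (K : ℕ) : (0 : ℝ) < (1 / 4) ^ K := by positivity

lemma pow_eighth_pos (K : ℕ) : (0 : ℝ) < (1 / 8) ^ K := by positivity

lemma repG_lt_attG (K : ℕ) : repG K < attG K := by
  have := pow_eighth_pos K
  unfold repG attG
  linarith

lemma attG_lt_repG_succ (K : ℕ) : attG K < repG (K + 1) := by
  have := pow_eighth_pos K
  unfold repG attG
  rw [pow_succ]
  linarith

lemma repG_pos (K : ℕ) : 0 < repG K := by
  have : (1 / 8 : ℝ) ^ K ≤ 1 := pow_le_one₀ (by norm_num) (by norm_num)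
  unfold repG
  linarith

lemma attG_lt_one (K : ℕ) : attG K < 1 := by
  have := pow_eighth_pos K
  unfold attG
  linarith

lemma repG_not_mem_dyadics (K : ℕ) : repG K ∉ dyadics := by
  intro h
  refine five_thirds_not_mem_dyadics ?_
  have key : (5 / 3 : ℝ) = 4 * 8 ^ K * (1 - repG K) := by
    unfold repG
    rw [one_div_pow]
    field_simp
    norm_num
  rw [key]
  exact mul_mem (mul_mem (ofNat_mem _ 4) (pow_mem (ofNat_mem _ 8) _)) (sub_mem (one_mem _) h)

lemma attG_not_mem_dyadics (K : ℕ) : attG K ∉ dyadics := by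
  intro h
  refine five_thirds_not_mem_dyadics ?_
  have key : (5 / 3 : ℝ) = 16 * 8 ^ K * (1 - attG K) := by
    unfold attG
    rw [one_div_pow]
    field_simp
    norm_num
  rw [key]
  exact mul_mem (mul_mem (ofNat_mem _ 16) (pow_mem (ofNat_mem _ 8) _)) (sub_mem (one_mem _) h)

section FixedPoints

variable {m K : ℕ}

lemma fEl_repF (hK : K ≤ m) : fEl (m + 2) (repF K) = repF K := by
  have := pow_quarter_pos K
  rw [repF, fEl_apply_expanding m K hK (by linarith) (by linarith)]
  ring

lemma fEl_attF (hK : K ≤ m) : fEl (m + 2) (attF K) = attF K := by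
  have := pow_quarter_pos K
  rw [attF, fEl_apply_contracting m K hK (by linarith) (by linarith)]
  ring

lemma gEl_repG (hK : K ≤ m) : gEl (m + 2) (repG K) = repG K := by
  have := pow_eighth_pos K
  rw [repG, gEl_apply_expanding m K hK (by linarith) (by linarith)]
  ring

lemma gEl_attG (hK : K ≤ m) : gEl (m + 2) (attG K) = attG K := by
  have := pow_eighth_pos K
  rw [attG, gEl_apply_contracting_right m K hK (by linarith) (by linarith)]
  ring

lemma fEl_ne_self_of_lt_repF_zero {t : ℝ} (h₀ : 0 < t) (h₁ : t < repF 0) :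
    fEl (m + 2) t ≠ t := by
  rw [repF, pow_zero] at h₁
  rcases le_total t (1 / 2) with h | h
  · rw [fEl_apply_left (m + 1) h₀.le h]
    linarith
  · obtain ⟨v, rfl⟩ : ∃ v, t = 1 - v := ⟨1 - t, by ring⟩
    rw [fEl_apply_expanding m 0 m.zero_le (by norm_num; linarith) (by norm_num; linarith),
      pow_zero]
    intro; linarith

lemma gEl_ne_self_of_lt_repG_zero {t : ℝ} (h₀ : 0 < t) (h₁ : t < repG 0) :
    gEl (m + 2) t ≠ t := by
  rw [repG, pow_zero] at h₁
  rcases le_total t (1 / 2) with h | h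
  · rw [gEl_apply_left (m + 1) h₀.le h]
    linarith
  · obtain ⟨v, rfl⟩ : ∃ v, t = 1 - v := ⟨1 - t, by ring⟩
    rw [gEl_apply_expanding m 0 m.zero_le (by norm_num; linarith) (by norm_num; linarith),
      pow_zero]
    intro; linarith

lemma fEl_ne_self_of_repF_lt_of_lt_attF (hK : K ≤ m) {t : ℝ} (h₀ : repF K < t)
    (h₁ : t < attF K) : fEl (m + 2) t ≠ t := by
  have := pow_quarter_pos K
  unfold repF at h₀
  unfold attF at h₁
  obtain ⟨v, rfl⟩ : ∃ v, t = 1 - v := ⟨1 - t, by ring⟩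
  intro heq
  rcases le_total (3 / 8 * (1 / 4) ^ K) v with h | h
  · rw [fEl_apply_expanding m K hK h (by linarith)] at heq
    linarith
  · rw [fEl_apply_contracting m K hK (by linarith) h] at heq
    linarith

lemma gEl_ne_self_of_repG_lt_of_lt_attG (hK : K ≤ m) {t : ℝ} (h₀ : repG K < t)
    (h₁ : t < attG K) : gEl (m + 2) t ≠ t := by
  have := pow_eighth_pos K
  unfold repG at h₀
  unfold attG at h₁
  obtain ⟨v, rfl⟩ : ∃ v, t = 1 - v := ⟨1 - t, by ring⟩
  intro heq
  rcases le_total (3 / 8 * (1 / 8) ^ K) v with h | h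
  · rw [gEl_apply_expanding m K hK h (by linarith)] at heq
    linarith
  rcases le_total (1 / 4 * (1 / 8) ^ K) v with h' | h'
  · rw [gEl_apply_translating m K hK h' h] at heq
    linarith
  rcases le_total (1 / 8 * (1 / 8) ^ K) v with h'' | h''
  · rw [gEl_apply_contracting_left m K hK h'' h'] at heq
    linarith
  · rw [gEl_apply_contracting_right m K hK (by linarith) h''] at heq
    linarith

lemma fEl_ne_self_of_attF_lt_of_lt_repF (hK : K + 1 ≤ m) {t : ℝ} (h₀ : attF K < t)
    (h₁ : t < repF (K + 1)) : fEl (m + 2) t ≠ t := by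
  have := pow_quarter_pos K
  have hpow : (1 / 4 : ℝ) ^ (K + 1) = (1 / 4) ^ K / 4 := by rw [pow_succ]; ring
  unfold repF at h₁
  unfold attF at h₀
  obtain ⟨v, rfl⟩ : ∃ v, t = 1 - v := ⟨1 - t, by ring⟩
  intro heq
  rcases le_total (1 / 8 * (1 / 4) ^ K) v with h | h
  · rw [fEl_apply_contracting m K (by omega) h (by linarith)] at heq
    linarith
  · rw [fEl_apply_expanding m (K + 1) hK (by linarith) (by linarith)] at heq
    linarith

lemma gEl_ne_self_of_attG_lt_of_lt_repG (hK : K + 1 ≤ m) {t : ℝ} (h₀ : attG K < t)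
    (h₁ : t < repG (K + 1)) : gEl (m + 2) t ≠ t := by
  have := pow_eighth_pos K
  have hpow : (1 / 8 : ℝ) ^ (K + 1) = (1 / 8) ^ K / 8 := by rw [pow_succ]; ring
  unfold repG at h₁
  unfold attG at h₀
  obtain ⟨v, rfl⟩ : ∃ v, t = 1 - v := ⟨1 - t, by ring⟩
  intro heq
  rcases le_total (1 / 16 * (1 / 8) ^ K) v with h | h
  · rw [gEl_apply_contracting_right m K (by omega) h (by linarith)] at heq
    linarith
  · rw [gEl_apply_expanding m (K + 1) hK (by linarith) (by linarith)] at heq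
    linarith

end FixedPoints

section Conjugator

variable {m K : ℕ} {h : Equiv.Perm ℝ}

lemma map_attG_of_map_repG (hmono : StrictMono h)
    (hH : Function.Semiconj h (gEl (m + 2)) (fEl (m + 2))) (hK : K ≤ m)
    (hrep : h (repG K) = repF K) : h (attG K) = attF K := by
  refine map_next_fixedPoint hmono hH hrep ?_ (repG_lt_attG K) (fEl_attF hK) (gEl_attG hK)
    (fun t => fEl_ne_self_of_repF_lt_of_lt_attF hK)
    (fun t => gEl_ne_self_of_repG_lt_of_lt_attG hK)
  have := pow_quarter_pos K
  unfold repF attF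
  linarith

lemma map_repG (hmono : StrictMono h) (h_zero : h 0 = 0)
    (hH : Function.Semiconj h (gEl (m + 2)) (fEl (m + 2))) (hK : K ≤ m) :
    h (repG K) = repF K := by
  induction K with
  | zero =>
    exact map_next_fixedPoint hmono hH h_zero (by norm_num [repF]) (repG_pos 0) (fEl_repF hK)
      (gEl_repG hK) (fun t => fEl_ne_self_of_lt_repF_zero) (fun t => gEl_ne_self_of_lt_repG_zero)
  | succ K ih =>
    refine map_next_fixedPoint hmono hH
      (map_attG_of_map_repG hmono hH (by omega) (ih (by omega))) ?_ (attG_lt_repG_succ K)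
      (fEl_repF hK) (gEl_repG hK) (fun t => fEl_ne_self_of_attF_lt_of_lt_repF hK)
      (fun t => gEl_ne_self_of_attG_lt_of_lt_repG hK)
    have := pow_quarter_pos K
    unfold repF attF
    rw [pow_succ]
    linarith

lemma map_attG (hmono : StrictMono h) (h_zero : h 0 = 0)
    (hH : Function.Semiconj h (gEl (m + 2)) (fEl (m + 2))) (hK : K ≤ m) :
    h (attG K) = attF K :=
  map_attG_of_map_repG hmono hH hK (map_repG hmono h_zero hH hK)

lemma two_zpow_sub_natCast (z : ℤ) (K : ℕ) : (2 : ℝ) ^ (z - K) = 2 ^ z * (1 / 2) ^ K := by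
  rw [zpow_sub₀ two_ne_zero, zpow_natCast, one_div_pow, div_eq_mul_one_div]

lemma eighth_pow_eq (K : ℕ) : (1 / 8 : ℝ) ^ K = (1 / 2) ^ K * (1 / 4) ^ K := by
  rw [← mul_pow]
  norm_num

variable {D : ℝ → ℤ} {l : ℕ}

lemma IsLogSlope.linear_repG (hD : IsLogSlope h D l)
    (hH : Function.Semiconj h (gEl (m + 2)) (fEl (m + 2))) (hK : K ≤ m) :
    ∃ δ > 0, ∀ x, |x| ≤ δ → h (repG K + x) = repF K + 2 ^ D (repG K) * x := by
  have := hD.linear _ (repG_not_mem_dyadics K) (repG_pos K) ((repG_lt_attG K).trans (attG_lt_one K))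
  rwa [map_repG hD.strictMono hD.map_zero hH hK] at this

lemma IsLogSlope.linear_attG (hD : IsLogSlope h D l)
    (hH : Function.Semiconj h (gEl (m + 2)) (fEl (m + 2))) (hK : K ≤ m) :
    ∃ δ > 0, ∀ x, |x| ≤ δ → h (attG K + x) = attF K + 2 ^ D (attG K) * x := by
  have := hD.linear _ (attG_not_mem_dyadics K) ((repG_pos K).trans (repG_lt_attG K)) (attG_lt_one K)
  rwa [map_attG hD.strictMono hD.map_zero hH hK] at this

lemma IsLogSlope.repG_add_attG (hD : IsLogSlope h D l)
    (hH : Function.Semiconj h (gEl (m + 2)) (fEl (m + 2))) (hK : K ≤ m) :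
    D (repG K) + D (attG K) = 2 * K - 1 := by
  have h4 := pow_quarter_pos K
  have h8 := pow_eighth_pos K
  have key := transit_exponents (P := repF K) (Q := attF K) (a := (1 / 4) ^ K / 24)
    (P' := repG K) (Q' := attG K) (b := (1 / 8) ^ K / 24) (ν := 1 / 2) (c := 2)
    (A := D (repG K) - K) (B := D (attG K) - 1 - K) hH (by positivity)
    (fun s hs₀ hs₁ => ?_) (fun r hr₀ hr₁ => ?_) (by unfold repF attF; ring)
    (fun s hs₀ hs₁ => ?_) (fun r hr₀ hr₁ => ?_) ?_ (hD.linear_repG hH hK) (hD.linear_attG hH hK)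
    ?_ ?_
  · push_cast at key
    linarith
  · have := mul_le_of_le_one_left h4.le hs₁
    have := mul_nonneg hs₀ h4.le
    rw [repF, show 1 - 5 / 12 * (1 / 4 : ℝ) ^ K + s * ((1 / 4) ^ K / 24) =
      1 - (5 / 12 * (1 / 4) ^ K - s * (1 / 4) ^ K / 24) by ring,
      fEl_apply_expanding m K hK (by linarith) (by linarith)]
    ring
  · have := mul_le_mul_of_nonneg_right hr₁ h4.le
    have := mul_nonneg hr₀ h4.le
    rw [attF, show 1 - 5 / 24 * (1 / 4 : ℝ) ^ K - r * ((1 / 4) ^ K / 24) =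
      1 - (5 / 24 * (1 / 4) ^ K + r * (1 / 4) ^ K / 24) by ring,
      fEl_apply_contracting m K hK (by linarith) (by linarith)]
    ring
  · have := mul_le_of_le_one_left h8.le hs₁
    have := mul_nonneg hs₀ h8.le
    rw [repG, show 1 - 5 / 12 * (1 / 8 : ℝ) ^ K + s * ((1 / 8) ^ K / 24) =
      1 - (5 / 12 * (1 / 8) ^ K - s * (1 / 8) ^ K / 24) by ring,
      gEl_apply_expanding m K hK (by linarith) (by linarith)]
    ring
  · have := mul_le_of_le_one_left h8.le hr₁
    have := mul_nonneg hr₀ h8.le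
    rw [attG, show 1 - 5 / 48 * (1 / 8 : ℝ) ^ K - r * (1 / 2 * ((1 / 8) ^ K / 24)) =
      1 - (5 / 48 * (1 / 8) ^ K + r * (1 / 8) ^ K / 48) by ring,
      gEl_apply_contracting_right m K hK (by linarith) (by linarith)]
    ring
  · rw [Function.iterate_succ_apply, Function.iterate_one, repG,
      show 1 - 5 / 12 * (1 / 8 : ℝ) ^ K + (1 / 8) ^ K / 24 = 1 - 3 / 8 * (1 / 8) ^ K by ring,
      gEl_apply_translating m K hK (by linarith) le_rfl,
      gEl_apply_contracting_left m K hK (by linarith) (by linarith), attG]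
    ring
  · rw [two_zpow_sub_natCast, eighth_pow_eq]
    ring
  · rw [two_zpow_sub_natCast, zpow_sub_one₀ two_ne_zero, eighth_pow_eq]
    ring

lemma IsLogSlope.repG_succ_add_attG (hD : IsLogSlope h D l)
    (hH : Function.Semiconj h (gEl (m + 2)) (fEl (m + 2))) (hK : K + 1 ≤ m) :
    D (repG (K + 1)) + D (attG K) = 2 * K + 2 := by
  have h4 := pow_quarter_pos K
  have h8 := pow_eighth_pos K
  have h4' : (1 / 4 : ℝ) ^ (K + 1) = (1 / 4) ^ K / 4 := by rw [pow_succ]; ring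
  have h8' : (1 / 8 : ℝ) ^ (K + 1) = (1 / 8) ^ K / 8 := by rw [pow_succ]; ring
  have hK' : K ≤ m := by omega
  have key := transit_exponents (P := repF (K + 1)) (Q := attF K) (a := -((1 / 4) ^ K / 48))
    (P' := repG (K + 1)) (Q' := attG K) (b := -((1 / 8) ^ K / 96)) (ν := 1) (c := 1)
    (A := D (repG (K + 1)) - 1 - K) (B := D (attG K) - 1 - K) hH (by linarith)
    (fun s hs₀ hs₁ => ?_) (fun r hr₀ hr₁ => ?_) (by unfold repF attF; rw [h4']; ring)
    (fun s hs₀ hs₁ => ?_) (fun r hr₀ hr₁ => ?_) ?_ (hD.linear_repG hH hK) (hD.linear_attG hH hK')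
    ?_ ?_
  · push_cast at key
    linarith
  · have := mul_le_of_le_one_left h4.le hs₁
    have := mul_nonneg hs₀ h4.le
    rw [repF, show 1 - 5 / 12 * (1 / 4 : ℝ) ^ (K + 1) + s * -((1 / 4) ^ K / 48) =
      1 - (5 / 12 * (1 / 4) ^ (K + 1) + s * (1 / 4) ^ K / 48) by ring,
      fEl_apply_expanding m (K + 1) hK (by linarith) (by linarith)]
    ring
  · have := mul_le_mul_of_nonneg_right hr₁ h4.le
    have := mul_nonneg hr₀ h4.le
    rw [attF, show 1 - 5 / 24 * (1 / 4 : ℝ) ^ K - r * -((1 / 4) ^ K / 48) =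
      1 - (5 / 24 * (1 / 4) ^ K - r * (1 / 4) ^ K / 48) by ring,
      fEl_apply_contracting m K hK' (by linarith) (by linarith)]
    ring
  · have := mul_le_of_le_one_left h8.le hs₁
    have := mul_nonneg hs₀ h8.le
    rw [repG, show 1 - 5 / 12 * (1 / 8 : ℝ) ^ (K + 1) + s * -((1 / 8) ^ K / 96) =
      1 - (5 / 12 * (1 / 8) ^ (K + 1) + s * (1 / 8) ^ K / 96) by ring,
      gEl_apply_expanding m (K + 1) hK (by linarith) (by linarith)]
    ring
  · have := mul_le_of_le_one_left h8.le hr₁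
    have := mul_nonneg hr₀ h8.le
    rw [attG, show 1 - 5 / 48 * (1 / 8 : ℝ) ^ K - r * (1 * -((1 / 8) ^ K / 96)) =
      1 - (5 / 48 * (1 / 8) ^ K - r * (1 / 8) ^ K / 96) by ring,
      gEl_apply_contracting_right m K hK' (by linarith) (by linarith)]
    ring
  · rw [Function.iterate_one, repG, h8',
      show 1 - 5 / 12 * ((1 / 8 : ℝ) ^ K / 8) + -((1 / 8) ^ K / 96) = 1 - 1 / 16 * (1 / 8) ^ K by
        ring,
      gEl_apply_contracting_right m K hK' le_rfl (by linarith), attG]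
    ring
  · rw [two_zpow_sub_natCast, zpow_sub_one₀ two_ne_zero, eighth_pow_eq]
    ring
  · rw [two_zpow_sub_natCast, zpow_sub_one₀ two_ne_zero, eighth_pow_eq]
    ring

lemma IsLogSlope.repG_eq (hD : IsLogSlope h D l)
    (hH : Function.Semiconj h (gEl (m + 2)) (fEl (m + 2))) (hK : K ≤ m) :
    D (repG K) = D (repG 0) + 3 * K := by
  induction K with
  | zero => simp
  | succ K ih =>
    have h₀ := ih (by omega)
    have h₁ := hD.repG_add_attG hH (K := K) (by omega)
    have h₂ := hD.repG_succ_add_attG hH hK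
    push_cast
    linarith

/-- The fixed points of `gEl n` in `(0, 1)` in increasing order. -/
def fixG (i : ℕ) : ℝ := if Even i then repG (i / 2) else attG (i / 2)

lemma fixG_two_mul (K : ℕ) : fixG (2 * K) = repG K := by
  simp [fixG]

lemma fixG_two_mul_add_one (K : ℕ) : fixG (2 * K + 1) = attG K := by
  rw [fixG, if_neg (by simp), show (2 * K + 1) / 2 = K by omega]

lemma monotone_fixG : Monotone fixG := by
  refine monotone_nat_of_le_succ fun i => ?_
  rcases Nat.even_or_odd' i with ⟨K, rfl | rfl⟩
  · rw [fixG_two_mul, fixG_two_mul_add_one]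
    exact (repG_lt_attG K).le
  · rw [fixG_two_mul_add_one, show 2 * K + 1 + 1 = 2 * (K + 1) by ring, fixG_two_mul]
    exact (attG_lt_repG_succ K).le

lemma IsLogSlope.two_mul_sq_le (hD : IsLogSlope h D l)
    (hH : Function.Semiconj h (gEl (m + 2)) (fEl (m + 2))) :
    2 * ((m : ℤ) ^ 2 - 1) ≤ 3 * l := by
  have hvar := hD.variation fixG monotone_fixG (2 * m)
  rw [sum_range_two_mul] at hvar
  have h₁ : ∑ K ∈ Finset.range m, |D (fixG (2 * K + 1)) - D (fixG (2 * K))| =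
      ∑ K ∈ Finset.range m, |4 * (K : ℤ) + (2 * D (repG 0) + 1)| := by
    refine Finset.sum_congr rfl fun K hK => ?_
    have hK := Finset.mem_range.1 hK
    rw [fixG_two_mul, fixG_two_mul_add_one, ← abs_neg]
    congr 1
    linarith [hD.repG_add_attG hH hK.le, hD.repG_eq hH hK.le]
  have h₂ : ∑ K ∈ Finset.range m, |D (fixG (2 * K + 1 + 1)) - D (fixG (2 * K + 1))| =
      ∑ K ∈ Finset.range m, |4 * (K : ℤ) + (2 * D (repG 0) + 4)| := by
    refine Finset.sum_congr rfl fun K hK => ?_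
    have hK := Finset.mem_range.1 hK
    rw [show 2 * K + 1 + 1 = 2 * (K + 1) by ring, fixG_two_mul, fixG_two_mul_add_one]
    congr 1
    linarith [hD.repG_succ_add_attG hH hK, hD.repG_add_attG hH hK.le, hD.repG_eq hH hK.le]
  rw [h₁, h₂] at hvar
  linarith [sq_sub_one_le_sum_abs m (2 * D (repG 0) + 1),
    sq_sub_one_le_sum_abs m (2 * D (repG 0) + 4)]

end Conjugator

theorem conjugator_of_fn_gn_long (n : ℕ) (hn : 2 ≤ n) (h : Equiv.Perm ℝ)
    (hh : h ∈ ThompsonF) (hc : h⁻¹ * fEl n * h = gEl n) :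
    ((n : ℝ) ^ 2 - 5 * (n : ℝ) - 4) / 2 ≤ (wordLength h : ℝ) := by
  obtain ⟨m, rfl⟩ : ∃ m, n = m + 2 := ⟨n - 2, by omega⟩
  obtain ⟨D, hD⟩ := exists_isLogSlope_wordLength hh
  have hH : Function.Semiconj h (gEl (m + 2)) (fEl (m + 2)) := fun t => by
    rw [← hc, Equiv.Perm.mul_apply, Equiv.Perm.mul_apply]
    exact h.apply_symm_apply _
  have hbound : 2 * ((m : ℝ) ^ 2 - 1) ≤ 3 * wordLength h := by
    exact_mod_cast hD.two_mul_sq_le hH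
  push_cast
  nlinarith [sq_nonneg (m : ℝ), (Nat.cast_nonneg m : (0 : ℝ) ≤ m)]

end
end
end

section
/- Let S be any finite generating set of Thompson's group V. There exists a constant C > 0 such that for all sufficiently large n there exist conjugate elements u, v of V with ℓ_S(u) + ℓ_S(v) ≤ n such that every h ∈ V with h⁻¹uh = v satisfies ℓ_S(h) ≥ C·n². In particular the conjugator length function of V (with respect to S) satisfies CLF(n) ≥ C·n² for all sufficiently large n. -/
noncomputable section

open Set

noncomputable section

open Set

/-- `a` and `b` are the endpoints of a standard dyadic interval `[k/2^m, (k+1)/2^m]`. -/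
def IsStdDyadicPair (a b : ℝ) : Prop :=
  ∃ k m : ℕ, a = (k : ℝ) / 2 ^ m ∧ b = ((k : ℝ) + 1) / 2 ^ m

/-- Membership in Thompson's group `V`, realized as permutations of `ℝ` that are the
identity outside `[0,1)`: there are partitions of `[0,1)` into standard dyadic intervals
`[a_{i−1}, a_i)` and `[b_{i−1}, b_i)` and a permutation `σ` such that `v` maps
`[a_{i−1}, a_i)` onto `[b_{σ(i)−1}, b_{σ(i)})` by an increasing affine map. -/
def MemV (v : Equiv.Perm ℝ) : Prop :=
  (∀ t, t ∉ Set.Ico (0:ℝ) 1 → v t = t) ∧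
  ∃ N : ℕ, ∃ a b : Fin (N + 1) → ℝ, ∃ σ : Equiv.Perm (Fin N),
    a 0 = 0 ∧ a (Fin.last N) = 1 ∧ b 0 = 0 ∧ b (Fin.last N) = 1 ∧
    StrictMono a ∧ StrictMono b ∧
    ∀ i : Fin N, IsStdDyadicPair (a i.castSucc) (a i.succ) ∧
      IsStdDyadicPair (b i.castSucc) (b i.succ) ∧
      ∃ c d : ℝ, 0 < c ∧
        (∀ t ∈ Set.Ico (a i.castSucc) (a i.succ), v t = c * t + d) ∧
        c * a i.castSucc + d = b (σ i).castSucc ∧ c * a i.succ + d = b (σ i).succ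

/-- Word length with respect to a set `S` (products of elements of `S ∪ S⁻¹`). -/
def wordLengthWith (S : Set (Equiv.Perm ℝ)) (v : Equiv.Perm ℝ) : ℕ :=
  sInf {n | ∃ w : List (Equiv.Perm ℝ), w.length = n ∧
    (∀ g ∈ w, g ∈ S ∨ g⁻¹ ∈ S) ∧ w.prod = v}

/-- `S` is a finite generating set of Thompson's group `V`. -/
def GeneratesV (S : Set (Equiv.Perm ℝ)) : Prop :=
  S.Finite ∧ (∀ s ∈ S, MemV s) ∧
  ∀ v, MemV v → ∃ w : List (Equiv.Perm ℝ), (∀ g ∈ w, g ∈ S ∨ g⁻¹ ∈ S) ∧ w.prod = v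

/-- Conjugator distance in `V` with respect to the generating set `S`. -/
def conjDistV (S : Set (Equiv.Perm ℝ)) (u v : Equiv.Perm ℝ) : ℕ :=
  sInf {n | ∃ h, MemV h ∧ h⁻¹ * u * h = v ∧ wordLengthWith S h = n}

/-- The conjugator length function of `V` with respect to the generating set `S`. -/
def CLFV (S : Set (Equiv.Perm ℝ)) (n : ℕ) : ℕ :=
  sSup {m | ∃ u v, MemV u ∧ MemV v ∧ (∃ h, MemV h ∧ h⁻¹ * u * h = v) ∧
    wordLengthWith S u + wordLengthWith S v ≤ n ∧ conjDistV S u v = m}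

lemma perm_apply_inv_self {α : Type*} (e : Equiv.Perm α) (x : α) : e (e⁻¹ x) = x :=
  e.apply_symm_apply x

lemma perm_inv_apply_self {α : Type*} (e : Equiv.Perm α) (x : α) : e⁻¹ (e x) = x :=
  e.symm_apply_apply x

/-! ### A uniform-subdivision description of `V` -/

/-- Every interval `[k/2^M, (k+1)/2^M)` is mapped affinely onto a standard dyadic interval. -/
def AffineAtLevel (v : Equiv.Perm ℝ) (M : ℕ) : Prop :=
  ∀ k : ℕ, k < 2 ^ M → ∃ l m : ℕ, ∀ t ∈ Ico (0:ℝ) 1, v ((k + t) / 2 ^ M) = (l + t) / 2 ^ m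

lemma mem_Ico_iff_of_fixes {v : Equiv.Perm ℝ} (hv : ∀ t, t ∉ Ico (0:ℝ) 1 → v t = t) (t : ℝ) :
    v t ∈ Ico (0:ℝ) 1 ↔ t ∈ Ico (0:ℝ) 1 := by
  constructor
  · intro h
    by_contra ht
    rw [hv t ht] at h
    exact ht h
  · intro h
    by_contra ht
    have := v.injective (hv _ ht)
    rw [this] at ht
    exact ht h

lemma cell_mem_Ico {k M : ℕ} (hk : k < 2 ^ M) {t : ℝ} (ht : t ∈ Ico (0:ℝ) 1) :
    ((k : ℝ) + t) / 2 ^ M ∈ Ico (0:ℝ) 1 := by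
  have h : (k : ℝ) + 1 ≤ 2 ^ M := by exact_mod_cast hk
  refine ⟨by have := ht.1; positivity, ?_⟩
  rw [div_lt_one (by positivity)]
  linarith [ht.2]

lemma lt_two_pow_of_cell_mem {l m : ℕ} (h : (l : ℝ) / 2 ^ m ∈ Ico (0:ℝ) 1) : l < 2 ^ m := by
  have := h.2
  rw [div_lt_one (by positivity)] at this
  exact_mod_cast this

lemma exists_cell (M : ℕ) {x : ℝ} (hx : x ∈ Ico (0:ℝ) 1) :
    ∃ k : ℕ, k < 2 ^ M ∧ ∃ t ∈ Ico (0:ℝ) 1, x = (k + t) / 2 ^ M := by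
  have hp : (0:ℝ) < 2 ^ M := by positivity
  have h0 : 0 ≤ x * 2 ^ M := mul_nonneg hx.1 hp.le
  refine ⟨⌊x * 2 ^ M⌋₊, ?_, x * 2 ^ M - ⌊x * 2 ^ M⌋₊, ⟨?_, ?_⟩, ?_⟩
  · rw [Nat.floor_lt h0]
    push_cast
    nlinarith [hx.2]
  · linarith [Nat.floor_le h0]
  · linarith [Nat.lt_floor_add_one (x * 2 ^ M)]
  · field_simp
    ring

lemma AffineAtLevel.subdivide {v : Equiv.Perm ℝ} {M : ℕ} (hv : AffineAtLevel v M) (d : ℕ) :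
    ∀ k : ℕ, k < 2 ^ (M + d) → ∃ l m : ℕ, ∀ t ∈ Ico (0:ℝ) 1,
      v ((k + t) / 2 ^ (M + d)) = (l + t) / 2 ^ (d + m) := by
  intro k hk
  obtain ⟨l, m, h⟩ := hv (k / 2 ^ d) (by
    rw [Nat.div_lt_iff_lt_mul (by positivity), ← pow_add]; exact hk)
  refine ⟨l * 2 ^ d + k % 2 ^ d, m, fun t ht => ?_⟩
  have hkr : ((k / 2 ^ d : ℕ) : ℝ) * 2 ^ d + (k % 2 ^ d : ℕ) = k := by
    exact_mod_cast Nat.div_add_mod' k (2 ^ d)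
  have hs := h ((((k % 2 ^ d : ℕ) : ℝ) + t) / 2 ^ d)
    (cell_mem_Ico (Nat.mod_lt _ (by positivity)) ht)
  have e1 : ((k : ℝ) + t) / 2 ^ (M + d) =
      (((k / 2 ^ d : ℕ) : ℝ) + (((k % 2 ^ d : ℕ) : ℝ) + t) / 2 ^ d) / 2 ^ M := by
    rw [← hkr, pow_add]
    field_simp
    ring
  rw [e1, hs]
  push_cast
  rw [pow_add]
  field_simp
  ring

lemma AffineAtLevel.mono {v : Equiv.Perm ℝ} {M : ℕ} (hv : AffineAtLevel v M) (d : ℕ) :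
    AffineAtLevel v (M + d) := fun k hk => by
  obtain ⟨l, m, h⟩ := hv.subdivide d k hk
  exact ⟨l, d + m, h⟩

/-- Thompson's group `V` as a subgroup of the permutations of `ℝ`. -/
def thompsonV : Subgroup (Equiv.Perm ℝ) where
  carrier := {v | (∀ t, t ∉ Ico (0:ℝ) 1 → v t = t) ∧ ∃ M, AffineAtLevel v M}
  one_mem' := ⟨fun _ _ => rfl, 0, fun k _ => ⟨k, 0, fun _ _ => rfl⟩⟩
  mul_mem' := by
    rintro v w ⟨hv, M, hvM⟩ ⟨hw, M', hwM⟩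
    refine ⟨fun t ht => by rw [Equiv.Perm.mul_apply, hw t ht, hv t ht], M' + M, ?_⟩
    intro k hk
    obtain ⟨l, m, h⟩ := hwM.subdivide M k hk
    have hl : l < 2 ^ (M + m) := by
      apply lt_two_pow_of_cell_mem
      have h0 := h 0 (by simp)
      rw [add_zero (l : ℝ)] at h0
      rw [← h0, mem_Ico_iff_of_fixes hw]
      exact cell_mem_Ico hk (by simp)
    obtain ⟨l', m', h'⟩ := hvM.mono m l hl
    exact ⟨l', m', fun t ht => by rw [Equiv.Perm.mul_apply, h t ht, h' t ht]⟩
  inv_mem' := by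
    rintro v ⟨hv, M, hvM⟩
    refine ⟨fun t ht => by rw [Equiv.Perm.inv_eq_iff_eq, hv t ht], ?_⟩
    choose! l m h using hvM
    refine ⟨(Finset.range (2 ^ M)).sup m, fun j hj => ?_⟩
    set R := (Finset.range (2 ^ M)).sup m
    have hx : v⁻¹ ((j : ℝ) / 2 ^ R) ∈ Ico (0:ℝ) 1 := by
      rw [← mem_Ico_iff_of_fixes hv, perm_apply_inv_self]
      simpa using cell_mem_Ico hj (t := 0) (by simp)
    obtain ⟨k, hk, s, hs, hks⟩ := exists_cell M hx
    obtain ⟨d, hd⟩ : ∃ d, R = m k + d :=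
      Nat.exists_eq_add_of_le (Finset.le_sup (f := m) (Finset.mem_range.2 hk))
    have e : (j : ℝ) / 2 ^ R = (l k + s) / 2 ^ m k := by
      rw [← h k hk s hs, ← hks, perm_apply_inv_self]
    have hp : (0:ℝ) < 2 ^ d := by positivity
    have e2 : (j : ℝ) = l k * 2 ^ d + s * 2 ^ d := by
      rw [hd, pow_add] at e
      field_simp at e
      linarith
    have hjl : l k * 2 ^ d ≤ j := by
      have : (l k : ℝ) * 2 ^ d ≤ j := by nlinarith [hs.1]
      exact_mod_cast this
    obtain ⟨r, rfl⟩ := Nat.exists_eq_add_of_le hjl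
    have hr : r < 2 ^ d := by
      push_cast at e2
      have : (r : ℝ) < 2 ^ d := by nlinarith [hs.2]
      exact_mod_cast this
    refine ⟨k * 2 ^ d + r, M + d, fun t ht => ?_⟩
    rw [Equiv.Perm.inv_eq_iff_eq]
    have e3 : (((k * 2 ^ d + r : ℕ) : ℝ) + t) / 2 ^ (M + d) =
        (k + ((r : ℝ) + t) / 2 ^ d) / 2 ^ M := by
      push_cast
      rw [pow_add]
      field_simp
      ring
    rw [e3, h k hk _ (cell_mem_Ico hr ht), hd, pow_add]
    push_cast
    field_simp
    ring

lemma fixes_of_mem_thompsonV {v : Equiv.Perm ℝ} (hv : v ∈ thompsonV) :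
    ∀ t, t ∉ Ico (0:ℝ) 1 → v t = t := hv.1

/-- Endpoints of a finite tiling of `[0,1)` can be listed increasingly. -/
lemma exists_sorted_tiling {N : ℕ} (p q : Fin N → ℝ) (hpq : ∀ i, p i < q i)
    (h0 : ∀ i, 0 ≤ p i) (h1 : ∀ i, q i ≤ 1)
    (hcover : ∀ x ∈ Ico (0:ℝ) 1, ∃ i, x ∈ Ico (p i) (q i))
    (hdisj : ∀ i j x, x ∈ Ico (p i) (q i) → x ∈ Ico (p j) (q j) → i = j) :
    ∃ (b : Fin (N + 1) → ℝ) (σ : Equiv.Perm (Fin N)), b 0 = 0 ∧ b (Fin.last N) = 1 ∧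
      StrictMono b ∧ ∀ i, b (σ i).castSucc = p i ∧ b (σ i).succ = q i := by
  classical
  have hinj : Function.Injective p := fun i j hij =>
    hdisj i j (p i) ⟨le_rfl, hpq i⟩ ⟨hij.ge, hij ▸ hpq j⟩
  have hcard : (Finset.univ.image p).card = N := by
    rw [Finset.card_image_of_injective _ hinj, Finset.card_univ, Fintype.card_fin]
  let e := (Finset.univ.image p).orderIsoOfFin hcard
  have hpe : ∀ i, p i ∈ Finset.univ.image p := fun i =>
    Finset.mem_image_of_mem _ (Finset.mem_univ i)
  let f : Fin N → Fin N := fun i => e.symm ⟨p i, hpe i⟩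
  have hf : Function.Injective f := fun i j hij => by
    have := e.symm.injective hij
    exact hinj (by simpa using this)
  let σ : Equiv.Perm (Fin N) := Equiv.ofBijective f (Finite.injective_iff_bijective.1 hf)
  have hσ : ∀ i, ((e (σ i)) : ℝ) = p i := fun i => by
    change ((e (e.symm ⟨p i, hpe i⟩)) : ℝ) = p i
    simp
  have hlt : ∀ i, p i < 1 := fun i => (hpq i).trans_le (h1 i)
  let b : Fin (N + 1) → ℝ := Fin.snoc (α := fun _ => ℝ) (fun i => ((e i) : ℝ)) 1
  have hbc : ∀ i : Fin N, b i.castSucc = e i := fun i => by simp [b]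
  have hbl : b (Fin.last N) = 1 := by simp [b]
  have he : ∀ i, ((e i) : ℝ) < 1 := fun i => by
    rw [← σ.apply_symm_apply i, hσ]; exact hlt _
  have hmono : StrictMono b := by
    intro i j
    refine Fin.lastCases ?_ (fun j => ?_) j
    · refine Fin.lastCases (fun h => absurd h (lt_irrefl _)) (fun i _ => ?_) i
      rw [hbc, hbl]; exact he i
    · refine Fin.lastCases (fun h => absurd h (not_lt.2 (Fin.le_last _))) (fun i h => ?_) i
      rw [hbc, hbc]
      exact e.strictMono (by simpa using h)
  have hgap : ∀ i j, p i < p j → q i ≤ p j := fun i j hij => by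
    by_contra! hlt'
    have := hdisj i j (p j) ⟨hij.le, hlt'⟩ ⟨le_rfl, hpq j⟩
    exact hij.ne (by rw [this])
  have hsucc : ∀ i, b (σ i).succ = q i := by
    intro i
    apply le_antisymm
    · rcases (h1 i).lt_or_eq with hq | hq
      · obtain ⟨j, hj⟩ := hcover (q i) ⟨(h0 i).trans (hpq i).le, hq⟩
        have hpj : p i < p j := by
          by_contra! hle
          have := hdisj i j (p i) ⟨le_rfl, hpq i⟩ ⟨hle, (hpq i).trans hj.2⟩
          subst this
          exact lt_irrefl _ hj.2
        have : σ i < σ j := by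
          rw [← e.lt_iff_lt]
          change ((e (σ i)) : ℝ) < e (σ j)
          rwa [hσ, hσ]
        calc b (σ i).succ ≤ b (σ j).castSucc := hmono.monotone (by
              rw [Fin.le_def]; simpa using this)
          _ = p j := by rw [hbc, hσ]
          _ ≤ q i := hj.1
      · rw [hq, ← hbl]
        exact hmono.monotone (Fin.le_last _)
    · have hi : p i < b (σ i).succ := by
        rw [← hσ, ← hbc]
        exact hmono (Fin.castSucc_lt_succ)
      induction hx : (σ i).succ using Fin.lastCases with
      | last => rw [hbl]; exact h1 i
      | cast j =>
        rw [hx, hbc, ← σ.apply_symm_apply j, hσ] at hi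
        rw [hbc, ← σ.apply_symm_apply j, hσ]
        exact hgap _ _ hi
  refine ⟨b, σ, ?_, hbl, hmono, fun i => ⟨by rw [hbc, hσ], hsucc i⟩⟩
  obtain ⟨i, hi⟩ := hcover 0 (by simp)
  have hpi : p i = 0 := le_antisymm hi.1 (h0 i)
  apply le_antisymm
  · rw [← hpi, ← hσ, ← hbc]
    exact hmono.monotone (Fin.zero_le _)
  · induction hx : (0 : Fin (N + 1)) using Fin.lastCases with
    | last => rw [hbl]; norm_num
    | cast j => rw [hbc, ← σ.apply_symm_apply j, hσ]; exact h0 _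

lemma memV_of_mem_thompsonV {v : Equiv.Perm ℝ} (hv : v ∈ thompsonV) : MemV v := by
  obtain ⟨hfix, M, hM⟩ := hv
  refine ⟨hfix, ?_⟩
  choose! l m h using hM
  have hp : ∀ n : ℕ, (0:ℝ) < 2 ^ n := fun n => by positivity
  have hcell : ∀ i : Fin (2 ^ M), ∀ x, x ∈ Ico ((l i : ℝ) / 2 ^ m i) ((l i + 1) / 2 ^ m i) →
      ∃ t ∈ Ico (0:ℝ) 1, x = v (((i : ℕ) + t) / 2 ^ M) := by
    intro i x hx
    rw [mem_Ico, div_le_iff₀ (hp _), lt_div_iff₀ (hp _)] at hx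
    refine ⟨x * 2 ^ m i - l i, ⟨by linarith, by linarith⟩, ?_⟩
    rw [h i i.2 _ ⟨by linarith, by linarith⟩]
    field_simp
    ring
  obtain ⟨b, σ, hb0, hb1, hbm, hb⟩ := exists_sorted_tiling
    (fun i : Fin (2 ^ M) => (l i : ℝ) / 2 ^ m i) (fun i => (l i + 1) / 2 ^ m i)
    (fun i => by gcongr; linarith) (fun i => by positivity)
    (fun i => by
      have hl : l i < 2 ^ m i := by
        apply lt_two_pow_of_cell_mem
        have h0 := h i i.2 0 (by simp)
        rw [add_zero (l i : ℝ)] at h0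
        rw [← h0, mem_Ico_iff_of_fixes hfix]
        exact cell_mem_Ico i.2 (by simp)
      rw [div_le_one (hp _)]
      exact_mod_cast hl)
    (fun x hx => by
      have hx' : v⁻¹ x ∈ Ico (0:ℝ) 1 := by
        rw [← mem_Ico_iff_of_fixes hfix, perm_apply_inv_self]; exact hx
      obtain ⟨k, hk, t, ht, hkt⟩ := exists_cell M hx'
      rw [Equiv.Perm.inv_eq_iff_eq, h k hk t ht] at hkt
      refine ⟨⟨k, hk⟩, ?_⟩
      rw [hkt, mem_Ico]
      constructor
      · gcongr; linarith [ht.1]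
      · gcongr; exact ht.2)
    (fun i j x hi hj => by
      obtain ⟨t, ht, hxt⟩ := hcell i x hi
      obtain ⟨s, hs, hxs⟩ := hcell j x hj
      have := v.injective (hxt.symm.trans hxs)
      rw [div_left_inj' (hp M).ne'] at this
      have h1 : ((i : ℕ) : ℝ) < (j : ℕ) + 1 := by linarith [ht.1, hs.2]
      have h2 : ((j : ℕ) : ℝ) < (i : ℕ) + 1 := by linarith [ht.2, hs.1]
      have h1' : (i : ℕ) < j + 1 := by exact_mod_cast h1
      have h2' : (j : ℕ) < i + 1 := by exact_mod_cast h2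
      exact Fin.ext (by omega))
  refine ⟨2 ^ M, fun i => ((i : ℕ) : ℝ) / 2 ^ M, b, σ, by simp, by simp, hb0, hb1, ?_, hbm, ?_⟩
  · intro i j hij
    have : (i : ℕ) < j := hij
    dsimp only
    gcongr
  · intro i
    refine ⟨⟨i, M, by simp, by simp⟩, ?_,
      2 ^ M / 2 ^ m i, (l i - (i : ℕ)) / 2 ^ m i, by positivity, ?_, ?_, ?_⟩
    · rw [← σ.apply_symm_apply i]
      exact ⟨_, _, (hb (σ.symm i)).1, (hb (σ.symm i)).2⟩
    · intro t ht
      simp only [Fin.val_castSucc, Fin.val_succ, mem_Ico, div_le_iff₀ (hp _),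
        lt_div_iff₀ (hp _)] at ht
      push_cast at ht
      have := h i i.2 (t * 2 ^ M - (i : ℕ)) ⟨by linarith, by linarith⟩
      rw [show ((i : ℕ) + (t * 2 ^ M - (i : ℕ))) / 2 ^ M = t by field_simp; ring] at this
      rw [this]
      field_simp
      ring
    · rw [(hb i).1]
      simp only [Fin.val_castSucc]
      field_simp
      ring
    · rw [(hb i).2]
      simp only [Fin.val_succ]
      push_cast
      field_simp
      ring

/-! ### Word length and discontinuities -/

/-- `g` is a product of `n` elements of `S ∪ S⁻¹`. -/
def IsWordOfLength (S : Set (Equiv.Perm ℝ)) (g : Equiv.Perm ℝ) (n : ℕ) : Prop :=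
  ∃ w : List (Equiv.Perm ℝ), w.length = n ∧ (∀ g ∈ w, g ∈ S ∨ g⁻¹ ∈ S) ∧ w.prod = g

namespace IsWordOfLength

variable {S : Set (Equiv.Perm ℝ)} {f g : Equiv.Perm ℝ} {m n : ℕ}

lemma wordLengthWith_le (h : IsWordOfLength S g n) : wordLengthWith S g ≤ n :=
  Nat.sInf_le h

lemma of_wordLengthWith (h : IsWordOfLength S g n) :
    IsWordOfLength S g (wordLengthWith S g) :=
  Nat.sInf_mem (s := {n | IsWordOfLength S g n}) ⟨n, h⟩

lemma mul (hf : IsWordOfLength S f m) (hg : IsWordOfLength S g n) :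
    IsWordOfLength S (f * g) (m + n) := by
  obtain ⟨w, rfl, hw, rfl⟩ := hf
  obtain ⟨w', rfl, hw', rfl⟩ := hg
  refine ⟨w ++ w', by simp, fun x hx => ?_, by simp⟩
  rcases List.mem_append.1 hx with h | h
  exacts [hw x h, hw' x h]

lemma inv (hg : IsWordOfLength S g n) : IsWordOfLength S g⁻¹ n := by
  obtain ⟨w, rfl, hw, rfl⟩ := hg
  refine ⟨(w.map (·⁻¹)).reverse, by simp, fun x hx => ?_, (List.prod_inv_reverse w).symm⟩
  simp only [List.mem_reverse, List.mem_map] at hx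
  obtain ⟨y, hy, rfl⟩ := hx
  rw [inv_inv]
  exact (hw y hy).symm

lemma pow (hg : IsWordOfLength S g n) (k : ℕ) : IsWordOfLength S (g ^ k) (k * n) := by
  induction k with
  | zero => exact ⟨[], by simp, by simp, by simp⟩
  | succ k ih => rw [pow_succ, add_mul, one_mul]; exact ih.mul hg

end IsWordOfLength

lemma GeneratesV.exists_isWordOfLength {S : Set (Equiv.Perm ℝ)} (hS : GeneratesV S)
    {g : Equiv.Perm ℝ} (hg : MemV g) : ∃ n, IsWordOfLength S g n := by
  obtain ⟨w, hw, hp⟩ := hS.2.2 g hg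
  exact ⟨w.length, w, rfl, hw, hp⟩

/-- The points at which `g` is discontinuous. -/
def discontinuitySet (g : Equiv.Perm ℝ) : Set ℝ := {t | ¬ ContinuousAt g t}

lemma discontinuitySet_mul_subset (f g : Equiv.Perm ℝ) :
    discontinuitySet (f * g) ⊆ discontinuitySet g ∪ g ⁻¹' discontinuitySet f := by
  intro t ht
  by_contra hcon
  simp only [discontinuitySet, mem_union, mem_ofPred_eq, mem_preimage, not_or, not_not] at hcon
  exact ht (ContinuousAt.comp (g := f) hcon.2 hcon.1)

lemma MemV.inv {v : Equiv.Perm ℝ} (hv : MemV v) : MemV v⁻¹ := by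
  obtain ⟨hfix, N, a, b, σ, ha0, ha1, hb0, hb1, ham, hbm, h⟩ := hv
  refine ⟨fun t ht => by rw [Equiv.Perm.inv_eq_iff_eq, hfix t ht], N, b, a, σ⁻¹,
    hb0, hb1, ha0, ha1, hbm, ham, fun i => ⟨(h i).2.1, (h i).1, ?_⟩⟩
  obtain ⟨j, rfl⟩ := σ.surjective i
  obtain ⟨-, -, c, d, hc, hv, hl, hr⟩ := h j
  rw [perm_inv_apply_self]
  refine ⟨c⁻¹, -(c⁻¹ * d), inv_pos.2 hc, fun t ht => ?_, ?_, ?_⟩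
  · rw [← hl, ← hr, mem_Ico] at ht
    rw [Equiv.Perm.inv_eq_iff_eq, hv]
    · field_simp; ring
    · constructor
      · have : a j.castSucc = c⁻¹ * (c * a j.castSucc + d) + -(c⁻¹ * d) := by field_simp; ring
        rw [this]; gcongr; exact ht.1
      · have : a j.succ = c⁻¹ * (c * a j.succ + d) + -(c⁻¹ * d) := by field_simp; ring
        rw [this]; gcongr; exact ht.2
  · rw [← hl]; field_simp; ring
  · rw [← hr]; field_simp; ring

lemma exists_mem_Ico_of_partition {N : ℕ} {a : Fin (N + 1) → ℝ} {t : ℝ}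
    (h0 : a 0 ≤ t) (h1 : t < a (Fin.last N)) :
    ∃ i : Fin N, t ∈ Ico (a i.castSucc) (a i.succ) := by
  by_contra! hcon
  have : ∀ i : Fin (N + 1), a i ≤ t := by
    intro i
    induction i using Fin.induction with
    | zero => exact h0
    | succ i ih =>
      by_contra! h
      exact hcon i ⟨ih, h⟩
  exact absurd h1 (not_lt.2 (this _))

lemma MemV.finite_discontinuitySet {v : Equiv.Perm ℝ} (hv : MemV v) :
    (discontinuitySet v).Finite := by
  obtain ⟨hfix, N, a, b, σ, ha0, ha1, hb0, hb1, ham, hbm, h⟩ := hv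
  refine (finite_range a).subset fun t ht => ?_
  by_contra hta
  refine ht ?_
  have hne : ∀ i, a i ≠ t := fun i hi => hta ⟨i, hi⟩
  rcases lt_or_ge t 0 with h0 | h0
  · refine continuousAt_id.congr ?_
    filter_upwards [Iio_mem_nhds h0] with s hs
    exact (hfix s (fun h => absurd h.1 (not_le.2 hs))).symm
  rcases lt_or_ge t 1 with h1 | h1
  · obtain ⟨i, hi⟩ := exists_mem_Ico_of_partition (a := a) (ha0.symm ▸ h0) (ha1.symm ▸ h1)
    obtain ⟨-, -, c, d, -, hcd, -, -⟩ := h i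
    have hc : ContinuousAt (fun s : ℝ => c * s + d) t := by fun_prop
    refine hc.congr ?_
    filter_upwards [Ioo_mem_nhds (lt_of_le_of_ne hi.1 (hne _)) hi.2] with s hs
    exact (hcd s ⟨hs.1.le, hs.2⟩).symm
  · have h1' : 1 < t := lt_of_le_of_ne h1 (by rw [← ha1]; exact hne _)
    refine continuousAt_id.congr ?_
    filter_upwards [Ioi_mem_nhds h1'] with s hs
    exact (hfix s (fun h => absurd h.2 (not_lt.2 (le_of_lt hs)))).symm

/-- The number of discontinuities grows at most linearly with word length. -/
lemma GeneratesV.exists_ncard_discontinuitySet_le {S : Set (Equiv.Perm ℝ)} (hS : GeneratesV S) :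
    ∃ B : ℕ, ∀ g n, IsWordOfLength S g n →
      (discontinuitySet g).Finite ∧ (discontinuitySet g).ncard ≤ n * B := by
  have hfin : (S ∪ S⁻¹).Finite := hS.1.union hS.1.inv
  have hletter : ∀ g, g ∈ S ∨ g⁻¹ ∈ S → (discontinuitySet g).Finite := by
    rintro g (hg | hg)
    · exact (hS.2.1 g hg).finite_discontinuitySet
    · simpa using (hS.2.1 _ hg).inv.finite_discontinuitySet
  obtain ⟨B, hB⟩ := (hfin.image fun g => (discontinuitySet g).ncard).bddAbove
  refine ⟨B, ?_⟩
  rintro g n ⟨w, rfl, hw, rfl⟩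
  induction w with
  | nil =>
    have : discontinuitySet 1 = ∅ := by
      ext t
      simpa [discontinuitySet] using (continuousAt_id : ContinuousAt (id : ℝ → ℝ) t)
    simp [this]
  | cons g w ih =>
    obtain ⟨ih1, ih2⟩ := ih fun x hx => hw x (List.mem_cons_of_mem _ hx)
    have hg := hw g List.mem_cons_self
    have hpre : (w.prod ⁻¹' discontinuitySet g).Finite :=
      (hletter g hg).preimage w.prod.injective.injOn
    have hsub := discontinuitySet_mul_subset g w.prod
    rw [List.prod_cons]
    refine ⟨(ih1.union hpre).subset hsub, ?_⟩
    have hgB : (discontinuitySet g).ncard ≤ B := hB ⟨g, hg, rfl⟩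
    have hcard : (w.prod ⁻¹' discontinuitySet g).ncard = (discontinuitySet g).ncard :=
      ncard_preimage_of_injective_subset_range w.prod.injective
        (by simp [w.prod.surjective.range_eq])
    calc _ ≤ _ := ncard_le_ncard hsub (ih1.union hpre)
      _ ≤ _ := ncard_union_le _ _
      _ ≤ w.length * B + B := add_le_add ih2 (hcard.trans_le hgB)
      _ = _ := by rw [List.length_cons, add_mul, one_mul]

/-! ### The dynamics of `x₀` -/

lemma x0_apply_of_le_half {t : ℝ} (h0 : 0 ≤ t) (h1 : t ≤ 1 / 2) : x0 t = t / 2 := by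
  change x0fun t = t / 2
  rw [x0fun, if_neg (not_lt.2 h0), if_pos h1]

lemma x0_pow_apply_of_le_half (k : ℕ) {t : ℝ} (h0 : 0 ≤ t) (h1 : t ≤ 1 / 2) :
    (x0 ^ k) t = t / 2 ^ k := by
  induction k with
  | zero => simp
  | succ k ih =>
    have hk : t / 2 ^ k ≤ t := div_le_self h0 (one_le_pow₀ (by norm_num))
    rw [pow_succ', Equiv.Perm.mul_apply, ih, x0_apply_of_le_half (by positivity) (by linarith),
      pow_succ]
    field_simp

lemma x0_mem_thompsonV : x0 ∈ thompsonV := by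
  refine ⟨fun t ht => ?_, 2, fun k hk => ?_⟩
  · change x0fun t = t
    rw [mem_Ico] at ht
    unfold x0fun
    split_ifs <;> first | rfl | (exfalso; apply ht; constructor <;> linarith) | skip
    all_goals
      have : t = 1 := by
        by_contra hne
        exact ht ⟨by linarith, lt_of_le_of_ne (by assumption) hne⟩
      linarith
  · have hcases : k = 0 ∨ k = 1 ∨ k = 2 ∨ k = 3 := by omega
    rcases hcases with rfl | rfl | rfl | rfl
    · refine ⟨0, 3, fun t ht => ?_⟩
      rw [x0_apply_of_le_half] <;> norm_num <;> linarith [ht.1, ht.2]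
    · refine ⟨1, 3, fun t ht => ?_⟩
      rw [x0_apply_of_le_half] <;> norm_num <;> linarith [ht.1, ht.2]
    · refine ⟨1, 2, fun t ht => ?_⟩
      obtain ⟨h1, h2⟩ := ht
      change x0fun _ = _
      unfold x0fun
      norm_num
      split_ifs <;> linarith
    · refine ⟨1, 1, fun t ht => ?_⟩
      obtain ⟨h1, h2⟩ := ht
      change x0fun _ = _
      unfold x0fun
      norm_num
      split_ifs <;> linarith

lemma continuous_x0 : Continuous x0 := by
  have h : (x0 : ℝ → ℝ) = fun t => if 0 ≤ t then (if t ≤ 1 / 2 then t / 2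
      else if t ≤ 3 / 4 then t - 1 / 4 else if t ≤ 1 then 2 * t - 1 else t) else t := by
    funext t
    change x0fun t = _
    unfold x0fun
    split_ifs <;> first | rfl | linarith
  rw [h]
  refine Continuous.if_le ?_ continuous_id continuous_const continuous_id
    (fun t ht => by subst ht; norm_num)
  refine Continuous.if_le (by fun_prop) ?_ continuous_id continuous_const
    (fun t ht => by subst ht; norm_num)
  refine Continuous.if_le (by fun_prop) ?_ continuous_id continuous_const
    (fun t ht => by subst ht; norm_num)
  exact Continuous.if_le (by fun_prop) continuous_id continuous_id continuous_const
    (fun t ht => by subst ht; norm_num)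

lemma continuous_x0_inv : Continuous (x0⁻¹ : Equiv.Perm ℝ) := by
  have h : ((x0⁻¹ : Equiv.Perm ℝ) : ℝ → ℝ) = fun t => if 0 ≤ t then (if t ≤ 1 / 4 then 2 * t
      else if t ≤ 1 / 2 then t + 1 / 4 else if t ≤ 1 then (t + 1) / 2 else t) else t := by
    funext t
    change x0inv t = _
    unfold x0inv
    split_ifs <;> first | rfl | linarith
  rw [h]
  refine Continuous.if_le ?_ continuous_id continuous_const continuous_id
    (fun t ht => by subst ht; norm_num)
  refine Continuous.if_le (by fun_prop) ?_ continuous_id continuous_const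
    (fun t ht => by subst ht; norm_num)
  refine Continuous.if_le (by fun_prop) ?_ continuous_id continuous_const
    (fun t ht => by subst ht; norm_num)
  exact Continuous.if_le (by fun_prop) continuous_id continuous_id continuous_const
    (fun t ht => by subst ht; norm_num)

lemma continuous_perm_pow {g : Equiv.Perm ℝ} (hg : Continuous g) (k : ℕ) :
    Continuous (g ^ k : Equiv.Perm ℝ) := by
  induction k with
  | zero => exact continuous_id
  | succ k ih => rw [pow_succ]; exact ih.comp hg

lemma continuous_x0_pow_inv (k : ℕ) : Continuous ((x0 ^ k)⁻¹ : Equiv.Perm ℝ) := by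
  rw [← inv_pow]
  exact continuous_perm_pow continuous_x0_inv k

lemma eq_zero_of_x0_apply_eq {t : ℝ} (ht : t ∈ Ico (0:ℝ) 1) (h : x0 t = t) : t = 0 := by
  obtain ⟨h0, h1⟩ := ht
  change x0fun t = t at h
  unfold x0fun at h
  split_ifs at h <;> linarith

lemma exists_x0_pow_le_half {t : ℝ} (ht : t ∈ Ioo (0:ℝ) 1) :
    ∃ k : ℕ, 0 < (x0 ^ k) t ∧ (x0 ^ k) t ≤ 1 / 2 := by
  have key : ∀ (j : ℕ) (t : ℝ), 0 < t → t ≤ 1 - (1 / 2) ^ (j + 1) →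
      ∃ k : ℕ, 0 < (x0 ^ k) t ∧ (x0 ^ k) t ≤ 1 / 2 := by
    intro j
    induction j with
    | zero => intro t h0 h1; exact ⟨0, by simpa using h0, by norm_num at h1 ⊢; exact h1⟩
    | succ j ih =>
      intro t h0 h1
      have hj : (0:ℝ) < (1 / 2) ^ (j + 1) := by positivity
      have hj' : ((1:ℝ) / 2) ^ (j + 1) ≤ 1 / 2 := by
        rw [pow_succ]
        have : ((1:ℝ) / 2) ^ j ≤ 1 := pow_le_one₀ (by norm_num) (by norm_num)
        linarith
      rw [pow_succ] at h1
      have hx : 0 < x0 t ∧ x0 t ≤ 1 - (1 / 2) ^ (j + 1) := by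
        change 0 < x0fun t ∧ x0fun t ≤ _
        unfold x0fun
        split_ifs <;> constructor <;> linarith
      obtain ⟨k, hk⟩ := ih _ hx.1 hx.2
      exact ⟨k + 1, by rwa [pow_succ]⟩
  obtain ⟨j, hj⟩ := exists_pow_lt_of_lt_one (sub_pos.2 ht.2) (by norm_num : (1 / 2 : ℝ) < 1)
  refine key j t ht.1 ?_
  rw [pow_succ]
  have : (0:ℝ) < (1 / 2) ^ j := by positivity
  linarith

lemma exists_x0_pow_lt {t ε : ℝ} (ht : t ∈ Ioo (0:ℝ) 1) (hε : 0 < ε) :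
    ∃ k : ℕ, (x0 ^ k) t ∈ Ioo 0 ε := by
  obtain ⟨k, h0, h1⟩ := exists_x0_pow_le_half ht
  obtain ⟨j, hj⟩ := exists_pow_lt_of_lt_one hε (by norm_num : (1 / 2 : ℝ) < 1)
  refine ⟨j + k, ?_⟩
  rw [pow_add, Equiv.Perm.mul_apply, x0_pow_apply_of_le_half j h0.le h1]
  refine ⟨by positivity, lt_of_le_of_lt ?_ hj⟩
  rw [div_eq_mul_inv, one_div, inv_pow]
  exact mul_le_of_le_one_left (by positivity) (by linarith)

/-- A permutation commuting with `x₀` that is linear near `0` is continuous on `(0,1)`. -/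
lemma continuousAt_of_commute_x0 {c : Equiv.Perm ℝ} (hc : Commute c x0) {μ ε : ℝ} (hε : 0 < ε)
    (hlin : ∀ t ∈ Ioo 0 ε, c t = μ * t) {t : ℝ} (ht : t ∈ Ioo (0:ℝ) 1) : ContinuousAt c t := by
  obtain ⟨k, hk⟩ := exists_x0_pow_lt ht hε
  have hcont := continuous_perm_pow continuous_x0 k
  have hcomp : Continuous fun s => ((x0 ^ k)⁻¹ : Equiv.Perm ℝ) (μ * (x0 ^ k) s) :=
    (continuous_x0_pow_inv k).comp (continuous_const.mul hcont)
  refine hcomp.continuousAt.congr ?_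
  filter_upwards [hcont.continuousAt (Ioo_mem_nhds hk.1 hk.2)] with s hs
  rw [← hlin _ hs, Equiv.Perm.inv_eq_iff_eq]
  exact (DFunLike.congr_fun (hc.pow_right k).eq s).symm ▸ rfl

/-! ### Copying a permutation into a fundamental domain of `x₀` and its translates -/

/-- The affine map sending `[0,1)` onto `[1/4,1/2)`. -/
def quarterMap : Equiv.Perm ℝ where
  toFun t := (1 + t) / 4
  invFun t := 4 * t - 1
  left_inv t := by ring
  right_inv t := by ring

/-- The copy of a permutation of `[0,1)` acting on `[1/4,1/2)`. -/
def quarterCopy (g : Equiv.Perm ℝ) : Equiv.Perm ℝ := quarterMap * g * quarterMap⁻¹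

lemma quarterCopy_apply (g : Equiv.Perm ℝ) (t : ℝ) :
    quarterCopy g t = (1 + g (4 * t - 1)) / 4 := rfl

lemma quarterCopy_mul (f g : Equiv.Perm ℝ) :
    quarterCopy (f * g) = quarterCopy f * quarterCopy g := by
  simp [quarterCopy, mul_assoc]

lemma quarterCopy_inv (g : Equiv.Perm ℝ) : quarterCopy g⁻¹ = (quarterCopy g)⁻¹ := by
  simp [quarterCopy, mul_assoc]

lemma quarterCopy_pow (g : Equiv.Perm ℝ) (k : ℕ) : quarterCopy (g ^ k) = quarterCopy g ^ k :=
  (conj_pow (i := k) (a := quarterMap) (b := g)).symm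

lemma quarterCopy_fixes {g : Equiv.Perm ℝ} (hg : ∀ t, t ∉ Ico (0:ℝ) 1 → g t = t) {t : ℝ}
    (ht : t ∉ Ico (1 / 4 : ℝ) (1 / 2)) : quarterCopy g t = t := by
  rw [quarterCopy_apply, hg]
  · ring
  · rintro ⟨h0, h1⟩
    exact ht ⟨by linarith, by linarith⟩

lemma quarterCopy_mem_thompsonV {g : Equiv.Perm ℝ} (hg : g ∈ thompsonV) :
    quarterCopy g ∈ thompsonV := by
  obtain ⟨hfix, M, hM⟩ := hg
  refine ⟨fun t ht => quarterCopy_fixes hfix fun h => ht ⟨by linarith [h.1], by linarith [h.2]⟩,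
    M + 2, fun k hk => ?_⟩
  by_cases hk' : 2 ^ M ≤ k ∧ k < 2 * 2 ^ M
  · obtain ⟨j, rfl⟩ := Nat.exists_eq_add_of_le hk'.1
    obtain ⟨l, m, h⟩ := hM j (by omega)
    refine ⟨2 ^ m + l, m + 2, fun t ht => ?_⟩
    have e : 4 * ((((2 ^ M + j : ℕ) : ℝ) + t) / 2 ^ (M + 2)) - 1 = (j + t) / 2 ^ M := by
      push_cast
      rw [pow_add]
      field_simp
      ring
    rw [quarterCopy_apply, e, h t ht]
    push_cast
    rw [pow_add]
    field_simp
    ring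
  · refine ⟨k, M + 2, fun t ht => quarterCopy_fixes hfix fun h => hk' ?_⟩
    obtain ⟨h0, h1⟩ := h
    rw [pow_add, le_div_iff₀ (by positivity)] at h0
    rw [pow_add, div_lt_iff₀ (by positivity)] at h1
    have a : (2:ℝ) ^ M < k + 1 := by linarith [ht.2]
    have b : (k:ℝ) < 2 * 2 ^ M := by linarith [ht.1]
    have a' : 2 ^ M < k + 1 := by exact_mod_cast a
    have b' : k < 2 * 2 ^ M := by exact_mod_cast b
    exact ⟨by omega, b'⟩

lemma not_continuousAt_quarterCopy {g : Equiv.Perm ℝ} {q : ℝ} (hq : ¬ ContinuousAt g q) :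
    ¬ ContinuousAt (quarterCopy g) ((1 + q) / 4) := by
  intro h
  refine hq ?_
  have h1 : ContinuousAt (fun t : ℝ => (1 + t) / 4) q := by fun_prop
  have h2 : ContinuousAt (fun t => 4 * quarterCopy g ((1 + t) / 4) - 1) q :=
    (continuousAt_const.mul
      (ContinuousAt.comp (f := fun t : ℝ => (1 + t) / 4) (g := quarterCopy g) h h1)).sub
      continuousAt_const
  refine h2.congr (Filter.Eventually.of_forall fun t => ?_)
  dsimp only
  rw [quarterCopy_apply, show 4 * ((1 + t) / 4) - 1 = t by ring]
  ring

/-- The copy of `g` acting on `[1/2^(k+2), 1/2^(k+1))`. -/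
def shiftCopy (g : Equiv.Perm ℝ) (k : ℕ) : Equiv.Perm ℝ :=
  x0 ^ k * quarterCopy g * (x0 ^ k)⁻¹

/-- The product of the copies of `g` acting on `[1/2^(k+2), 1/2^(k+1))` for `k < m`. -/
def spread (g : Equiv.Perm ℝ) (m : ℕ) : Equiv.Perm ℝ :=
  (quarterCopy g * x0) ^ m * (x0 ^ m)⁻¹

lemma spread_zero (g : Equiv.Perm ℝ) : spread g 0 = 1 := by simp [spread]

lemma spread_succ (g : Equiv.Perm ℝ) (m : ℕ) : spread g (m + 1) = spread g m * shiftCopy g m := by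
  simp only [spread, shiftCopy, pow_succ, mul_inv_rev, mul_assoc, inv_mul_cancel_left]
  simp [← mul_assoc]

lemma shiftCopy_fixes {g : Equiv.Perm ℝ} (hg : ∀ t, t ∉ Ico (0:ℝ) 1 → g t = t) (k : ℕ) {t : ℝ}
    (ht : t ∉ Ico (1 / 4 / 2 ^ k : ℝ) (1 / 2 / 2 ^ k)) : shiftCopy g k t = t := by
  rw [shiftCopy, Equiv.Perm.mul_apply, Equiv.Perm.mul_apply, quarterCopy_fixes hg,
    perm_apply_inv_self]
  intro h
  refine ht ?_
  have e := x0_pow_apply_of_le_half k (by linarith [h.1]) h.2.le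
  rw [perm_apply_inv_self] at e
  rw [e]
  exact ⟨by gcongr; exact h.1, by gcongr; exact h.2⟩

lemma shiftCopy_mem {g : Equiv.Perm ℝ} (hg : ∀ t, t ∉ Ico (0:ℝ) 1 → g t = t) (k : ℕ) {t : ℝ}
    (ht : t ∈ Ico (1 / 4 / 2 ^ k : ℝ) (1 / 2 / 2 ^ k)) :
    shiftCopy g k t ∈ Ico (1 / 4 / 2 ^ k : ℝ) (1 / 2 / 2 ^ k) := by
  by_contra h
  have := (shiftCopy g k).injective (shiftCopy_fixes hg k h)
  exact h (this.symm ▸ ht)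

lemma not_continuousAt_shiftCopy {g : Equiv.Perm ℝ} (k : ℕ) {q : ℝ} (hq : q ∈ Ioo (0:ℝ) 1)
    (hgq : ¬ ContinuousAt g q) : ¬ ContinuousAt (shiftCopy g k) ((1 + q) / 4 / 2 ^ k) := by
  intro h
  refine not_continuousAt_quarterCopy hgq ?_
  have hy := x0_pow_apply_of_le_half k (t := (1 + q) / 4) (by linarith [hq.1]) (by linarith [hq.2])
  rw [← hy] at h
  have h1 := ((continuous_x0_pow_inv k).continuousAt).comp
    (h.comp (continuous_perm_pow continuous_x0 k).continuousAt)
  refine h1.congr (Filter.Eventually.of_forall fun t => ?_)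
  simp only [Function.comp, shiftCopy, Equiv.Perm.mul_apply, perm_inv_apply_self]

lemma dyadic_scale_le {j k : ℕ} (h : j < k) : (1 / 2 / 2 ^ k : ℝ) ≤ 1 / 4 / 2 ^ j := by
  have h2 : (2:ℝ) ^ (j + 1) ≤ 2 ^ k := pow_le_pow_right₀ (by norm_num) h
  rw [div_le_div_iff₀ (by positivity) (by positivity)]
  rw [pow_succ] at h2
  linarith

lemma commute_shiftCopy {g : Equiv.Perm ℝ} (hg : ∀ t, t ∉ Ico (0:ℝ) 1 → g t = t) (k : ℕ) :
    Commute (quarterCopy g) (shiftCopy g k) := by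
  rcases Nat.eq_zero_or_pos k with rfl | hk
  · simp [shiftCopy]
  · refine Equiv.Perm.Disjoint.commute fun t => ?_
    by_cases ht : t ∈ Ico (1 / 4 / 2 ^ k : ℝ) (1 / 2 / 2 ^ k)
    · left
      refine quarterCopy_fixes hg fun h => ?_
      have := dyadic_scale_le hk
      norm_num at this
      linarith [h.1, ht.2]
    · exact Or.inr (shiftCopy_fixes hg k ht)

lemma spread_inv_mul_x0_mul_spread {g : Equiv.Perm ℝ} (hg : ∀ t, t ∉ Ico (0:ℝ) 1 → g t = t)
    (m : ℕ) : (spread g m)⁻¹ * x0 * spread g m = (quarterCopy g)⁻¹ * shiftCopy g m * x0 := by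
  rw [mul_assoc, inv_mul_eq_iff_eq_mul]
  induction m with
  | zero => simp [spread_zero, shiftCopy]
  | succ m ih =>
    have hx : x0 * shiftCopy g m = shiftCopy g (m + 1) * x0 := by
      simp [shiftCopy, pow_succ', mul_assoc]
    have hc := (commute_shiftCopy hg m).inv_left.eq
    calc x0 * spread g (m + 1) = (x0 * spread g m) * shiftCopy g m := by
          rw [spread_succ, mul_assoc]
      _ = spread g m * ((quarterCopy g)⁻¹ * shiftCopy g m) * (x0 * shiftCopy g m) := by
          rw [ih]; simp only [mul_assoc]
      _ = spread g (m + 1) * ((quarterCopy g)⁻¹ * shiftCopy g (m + 1) * x0) := by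
          rw [hx, hc, spread_succ]; simp only [mul_assoc]

lemma spread_mem_thompsonV {g : Equiv.Perm ℝ} (hg : g ∈ thompsonV) (m : ℕ) :
    spread g m ∈ thompsonV :=
  mul_mem (pow_mem (mul_mem (quarterCopy_mem_thompsonV hg) x0_mem_thompsonV) m)
    (inv_mem (pow_mem x0_mem_thompsonV m))

lemma spread_apply_of_lt {g : Equiv.Perm ℝ} (hg : ∀ t, t ∉ Ico (0:ℝ) 1 → g t = t) (m : ℕ) {t : ℝ}
    (ht : t < 1 / 2 / 2 ^ m) : spread g m t = t := by
  induction m with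
  | zero => simp [spread_zero]
  | succ m ih =>
    have hle := dyadic_scale_le (Nat.lt_add_one m)
    have hle' : (1 / 4 / 2 ^ m : ℝ) ≤ 1 / 2 / 2 ^ m := by gcongr; norm_num
    rw [spread_succ, Equiv.Perm.mul_apply, shiftCopy_fixes hg m, ih (by linarith)]
    exact fun h => absurd h.1 (by linarith)

lemma not_continuousAt_spread {g : Equiv.Perm ℝ} (hg : ∀ t, t ∉ Ico (0:ℝ) 1 → g t = t) {m k : ℕ}
    (hk : k < m) {q : ℝ} (hq : q ∈ Ioo (0:ℝ) 1) (hgq : ¬ ContinuousAt g q) :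
    ¬ ContinuousAt (spread g m) ((1 + q) / 4 / 2 ^ k) := by
  have hlow : ∀ k : ℕ, 1 / 4 / 2 ^ k < (1 + q) / 4 / 2 ^ k := fun k => by
    gcongr; linarith [hq.1]
  have hup : ∀ k : ℕ, (1 + q) / 4 / 2 ^ k < 1 / 2 / 2 ^ k := fun k => by
    gcongr ?_ / _; linarith [hq.2]
  induction m with
  | zero => omega
  | succ m ih =>
    intro h
    rw [spread_succ] at h
    rcases Nat.lt_succ_iff_lt_or_eq.1 hk with hlt | rfl
    · refine ih hlt (h.congr ?_)
      filter_upwards [Ioi_mem_nhds (hlow k)] with t ht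
      rw [Equiv.Perm.mul_apply, shiftCopy_fixes hg m]
      intro h'
      have := dyadic_scale_le hlt
      exact absurd h'.2 (not_lt.2 (this.trans (le_of_lt ht)))
    · refine not_continuousAt_shiftCopy k hq hgq (h.congr ?_)
      filter_upwards [Ioo_mem_nhds (hlow k) (hup k)] with t ht
      rw [Equiv.Perm.mul_apply, spread_apply_of_lt hg]
      exact (shiftCopy_mem hg k ⟨ht.1.le, ht.2⟩).2

/-! ### The conjugate pairs -/

/-- The permutation exchanging `[0,1/2)` and `[1/2,1)` by translation. -/
def swapHalves : Equiv.Perm ℝ :=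
  Function.Involutive.toPerm
    (fun t => if t < 0 then t else if t < 1 / 2 then t + 1 / 2 else if t < 1 then t - 1 / 2 else t)
    (fun t => by dsimp only; split_ifs <;> linarith)

lemma swapHalves_apply (t : ℝ) : swapHalves t =
    if t < 0 then t else if t < 1 / 2 then t + 1 / 2 else if t < 1 then t - 1 / 2 else t := rfl

lemma swapHalves_mem_thompsonV : swapHalves ∈ thompsonV := by
  refine ⟨fun t ht => ?_, 1, fun k hk => ?_⟩
  · rw [swapHalves_apply]
    split_ifs <;> first | rfl | exact absurd (by constructor <;> linarith) ht
  · have hcases : k = 0 ∨ k = 1 := by omega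
    rcases hcases with rfl | rfl
    · refine ⟨1, 1, fun t ⟨h0, h1⟩ => ?_⟩
      rw [swapHalves_apply]
      norm_num
      split_ifs <;> linarith
    · refine ⟨0, 1, fun t ⟨h0, h1⟩ => ?_⟩
      rw [swapHalves_apply]
      norm_num
      split_ifs <;> linarith

lemma not_continuousAt_swapHalves : ¬ ContinuousAt swapHalves (1 / 2) := by
  intro h
  rw [Metric.continuousAt_iff] at h
  obtain ⟨δ, hδ, h⟩ := h (1 / 4) (by norm_num)
  have hm : 0 < min δ (1 / 2) := lt_min hδ (by norm_num)
  have h1 := min_le_left δ (1 / 2)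
  have h2 := min_le_right δ (1 / 2)
  have := h (x := 1 / 2 - min δ (1 / 2) / 2) (by
    rw [Real.dist_eq, abs_lt]; constructor <;> linarith)
  rw [Real.dist_eq, abs_lt, swapHalves_apply, swapHalves_apply, if_neg (by linarith),
    if_pos (by linarith)] at this
  norm_num at this
  linarith [this.2]

lemma translate_mem_Ioo (k : ℕ) {q : ℝ} (hq : q ∈ Ioo (0:ℝ) 1) :
    (1 + q) / 4 / 2 ^ k ∈ Ioo (0:ℝ) 1 := by
  have h0 := hq.1
  refine ⟨by positivity,
    lt_of_le_of_lt (div_le_self (by positivity) (one_le_pow₀ (by norm_num))) ?_⟩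
  linarith [hq.2]

lemma translate_inj {j k : ℕ} {p q : ℝ} (hp : p ∈ Ioo (0:ℝ) 1) (hq : q ∈ Ioo (0:ℝ) 1)
    (h : (1 + p) / 4 / 2 ^ j = (1 + q) / 4 / 2 ^ k) : j = k ∧ p = q := by
  have key : ∀ {j k : ℕ} {p q : ℝ}, p ∈ Ioo (0:ℝ) 1 → q ∈ Ioo (0:ℝ) 1 → j < k →
      (1 + q) / 4 / 2 ^ k < (1 + p) / 4 / 2 ^ j := by
    intro j k p q hp hq hjk
    calc (1 + q) / 4 / 2 ^ k < 1 / 2 / 2 ^ k := by gcongr ?_ / _; linarith [hq.2]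
      _ ≤ 1 / 4 / 2 ^ j := dyadic_scale_le hjk
      _ < (1 + p) / 4 / 2 ^ j := by gcongr; linarith [hp.1]
  rcases lt_trichotomy j k with hjk | rfl | hjk
  · exact absurd h (key hp hq hjk).ne'
  · refine ⟨rfl, ?_⟩
    field_simp at h
    linarith
  · exact absurd h (key hq hp hjk).ne

/-- All conjugators from `x₀` to `h⁻¹ x₀ h` inherit the discontinuities of `h`. -/
lemma not_continuousAt_of_conj_eq {f h : Equiv.Perm ℝ} (hf : MemV f)
    (hh : ∀ t, t ∉ Ico (0:ℝ) 1 → h t = t) (hconj : f⁻¹ * x0 * f = h⁻¹ * x0 * h) {δ : ℝ}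
    (hδ : 0 < δ) (hid : ∀ t < δ, h t = t) {p : ℝ} (hp : p ∈ Ioo (0:ℝ) 1)
    (hdisc : ¬ ContinuousAt h p) : ¬ ContinuousAt f p := by
  have hcomm : Commute (h * f⁻¹) x0 := by
    have : h * (f⁻¹ * x0 * f) * f⁻¹ = h * (h⁻¹ * x0 * h) * f⁻¹ := by rw [hconj]
    simpa [Commute, SemiconjBy, mul_assoc] using this
  have hx00 : x0 0 = 0 := by rw [x0_apply_of_le_half] <;> norm_num
  have hd0 : (h * f⁻¹) 0 = 0 := by
    refine eq_zero_of_x0_apply_eq ?_ ?_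
    · rw [Equiv.Perm.mul_apply, mem_Ico_iff_of_fixes hh, mem_Ico_iff_of_fixes hf.inv.1]
      simp
    · rw [← Equiv.Perm.mul_apply, ← hcomm.eq, Equiv.Perm.mul_apply, hx00]
  have hfi0 : f⁻¹ 0 = 0 := by
    rw [Equiv.Perm.mul_apply] at hd0
    exact h.injective (hd0.trans (hid 0 hδ).symm)
  obtain ⟨μ, ε, hμ, hε, hlin⟩ : ∃ μ ε : ℝ, 0 < μ ∧ 0 < ε ∧ ∀ t ∈ Ioo 0 ε, f⁻¹ t = μ * t := by
    obtain ⟨-, N, a, b, σ, ha0, ha1, -, -, ham, -, hpieces⟩ := hf.inv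
    obtain ⟨i, hi⟩ := exists_mem_Ico_of_partition (a := a) (t := 0) ha0.le
      (by rw [ha1]; norm_num)
    obtain ⟨-, -, μ, d, hμ, hv, -, -⟩ := hpieces i
    have hd : d = 0 := by
      have := hv 0 hi
      rw [hfi0] at this
      linarith
    refine ⟨μ, a i.succ, hμ, hi.2, fun t ht => ?_⟩
    rw [hv t ⟨hi.1.trans ht.1.le, ht.2⟩, hd, add_zero]
  intro hcont
  have hfp : f p ∈ Ioo (0:ℝ) 1 := by
    have hmem := (mem_Ico_iff_of_fixes hf.1 p).2 ⟨hp.1.le, hp.2⟩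
    refine ⟨lt_of_le_of_ne hmem.1 fun h0 => hp.1.ne' ?_, hmem.2⟩
    rw [← perm_inv_apply_self f p, ← h0, hfi0]
  have hc : ContinuousAt (h * f⁻¹) (f p) :=
    continuousAt_of_commute_x0 hcomm (μ := μ) (lt_min hε (div_pos hδ hμ)) (fun t ht => by
      have h1 := hlin t ⟨ht.1, ht.2.trans_le (min_le_left _ _)⟩
      have h2 := ht.2.trans_le (min_le_right _ _)
      rw [lt_div_iff₀ hμ] at h2
      rw [Equiv.Perm.mul_apply, h1, hid _ (by linarith)]) hfp
  refine hdisc ((ContinuousAt.comp (g := (h * f⁻¹ : Equiv.Perm ℝ)) hc hcont).congr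
    (Filter.Eventually.of_forall fun t => ?_))
  simp only [Function.comp, Equiv.Perm.mul_apply, perm_inv_apply_self]

/-- A conjugator with quadratically many discontinuities. -/
def doubleSpread (n : ℕ) : Equiv.Perm ℝ := spread (spread swapHalves n) n

lemma doubleSpread_mem_thompsonV (n : ℕ) : doubleSpread n ∈ thompsonV :=
  spread_mem_thompsonV (spread_mem_thompsonV swapHalves_mem_thompsonV n) n

lemma sq_le_ncard_discontinuitySet {f : Equiv.Perm ℝ} (hf : MemV f) (n : ℕ)
    (hconj : f⁻¹ * x0 * f = (doubleSpread n)⁻¹ * x0 * doubleSpread n) :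
    n * n ≤ (discontinuitySet f).ncard := by
  have hhalf : (1 / 2 : ℝ) ∈ Ioo (0:ℝ) 1 := by norm_num
  let q : ℕ → ℝ := fun i => (1 + 1 / 2) / 4 / 2 ^ i
  have hq : ∀ i, q i ∈ Ioo (0:ℝ) 1 := fun i => translate_mem_Ioo i hhalf
  let P : Fin n × Fin n → ℝ := fun x => (1 + q x.1) / 4 / 2 ^ (x.2 : ℕ)
  have hP : Function.Injective P := by
    intro x y hxy
    obtain ⟨h2, h1⟩ := translate_inj (hq _) (hq _) hxy
    exact Prod.ext (Fin.ext (translate_inj hhalf hhalf h1).1) (Fin.ext h2)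
  have hfixS := fixes_of_mem_thompsonV swapHalves_mem_thompsonV
  have hfix := fixes_of_mem_thompsonV (spread_mem_thompsonV swapHalves_mem_thompsonV n)
  have hsub : range P ⊆ discontinuitySet f := by
    rintro _ ⟨x, rfl⟩
    refine not_continuousAt_of_conj_eq hf (fixes_of_mem_thompsonV (doubleSpread_mem_thompsonV n))
      hconj (δ := 1 / 2 / 2 ^ n) (by positivity) (fun t ht => spread_apply_of_lt hfix n ht)
      (translate_mem_Ioo _ (hq _)) ?_
    exact not_continuousAt_spread hfix x.2.2 (hq _)
      (not_continuousAt_spread hfixS x.1.2 hhalf not_continuousAt_swapHalves)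
  calc n * n = Nat.card (Fin n × Fin n) := by simp
    _ = (range P).ncard := (Nat.card_range_of_injective hP).symm
    _ ≤ _ := ncard_le_ncard hsub hf.finite_discontinuitySet

lemma GeneratesV.exists_conjugate_pairs {S : Set (Equiv.Perm ℝ)} (hS : GeneratesV S) :
    ∃ K B : ℕ, 0 < K ∧ ∀ n : ℕ, ∃ u v : Equiv.Perm ℝ, MemV u ∧ MemV v ∧
      (∃ h, MemV h ∧ h⁻¹ * u * h = v) ∧ wordLengthWith S u + wordLengthWith S v ≤ K * (n + 1) ∧
      ∀ h, MemV h → h⁻¹ * u * h = v → n * n ≤ wordLengthWith S h * B := by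
  obtain ⟨B, hB⟩ := hS.exists_ncard_discontinuitySet_le
  have hx := x0_mem_thompsonV
  obtain ⟨a, ha⟩ := hS.exists_isWordOfLength (memV_of_mem_thompsonV
    (quarterCopy_mem_thompsonV (quarterCopy_mem_thompsonV swapHalves_mem_thompsonV)))
  obtain ⟨b, hb⟩ := hS.exists_isWordOfLength (memV_of_mem_thompsonV (quarterCopy_mem_thompsonV hx))
  obtain ⟨c, hc⟩ := hS.exists_isWordOfLength (memV_of_mem_thompsonV hx)
  refine ⟨2 * a + 4 * b + 2 * c + 1, B, by omega, fun n => ?_⟩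
  have hd := doubleSpread_mem_thompsonV n
  refine ⟨x0, (doubleSpread n)⁻¹ * x0 * doubleSpread n, memV_of_mem_thompsonV hx,
    memV_of_mem_thompsonV (mul_mem (mul_mem (inv_mem hd) hx) hd),
    ⟨_, memV_of_mem_thompsonV hd, rfl⟩, ?_, fun h hh hconj => ?_⟩
  · have hcopy : IsWordOfLength S (quarterCopy (spread swapHalves n)) (n * (a + b) + n * b) := by
      rw [spread, quarterCopy_mul, quarterCopy_inv, quarterCopy_pow, quarterCopy_pow,
        quarterCopy_mul]
      exact ((ha.mul hb).pow n).mul (hb.pow n).inv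
    have hv := ((hcopy.inv.mul (((hc.pow n).mul hcopy).mul (hc.pow n).inv)).mul hc)
    have hfix := fixes_of_mem_thompsonV (spread_mem_thompsonV swapHalves_mem_thompsonV n)
    rw [← shiftCopy, ← spread_inv_mul_x0_mul_spread hfix, ← doubleSpread] at hv
    calc _ ≤ _ := add_le_add hc.wordLengthWith_le hv.wordLengthWith_le
      _ ≤ _ := by nlinarith
  · obtain ⟨k, hk⟩ := hS.exists_isWordOfLength hh
    exact (sq_le_ncard_discontinuitySet hh n hconj).trans (hB h _ hk.of_wordLengthWith).2

/-- Balls of `V` are finite, so the supremum defining `CLFV` is over a finite set. -/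
lemma GeneratesV.bddAbove_conjDistV {S : Set (Equiv.Perm ℝ)} (hS : GeneratesV S) (n : ℕ) :
    BddAbove {m | ∃ u v, MemV u ∧ MemV v ∧ (∃ h, MemV h ∧ h⁻¹ * u * h = v) ∧
      wordLengthWith S u + wordLengthWith S v ≤ n ∧ conjDistV S u v = m} := by
  have hletters : (S ∪ S⁻¹).Finite := hS.1.union hS.1.inv
  have : Finite ↥(S ∪ S⁻¹) := hletters
  have hball : {g | MemV g ∧ wordLengthWith S g ≤ n}.Finite := by
    have hlists : {w : List ↥(S ∪ S⁻¹) | w.length ≤ n}.Finite := List.finite_length_le _ n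
    refine (hlists.image fun w => (w.map Subtype.val).prod).subset ?_
    rintro g ⟨hg, hgn⟩
    obtain ⟨k, hk⟩ := hS.exists_isWordOfLength hg
    obtain ⟨w, hwl, hw, hwg⟩ := hk.of_wordLengthWith
    lift w to List ↥(S ∪ S⁻¹) using hw
    exact ⟨w, by simpa [← hwl] using hgn, hwg⟩
  refine ((hball.prod hball).image fun x => conjDistV S x.1 x.2).bddAbove.mono ?_
  rintro m ⟨u, v, hu, hv, -, hle, rfl⟩
  exact ⟨(u, v), ⟨⟨hu, (Nat.le_add_right _ _).trans hle⟩,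
    ⟨hv, (Nat.le_add_left _ _).trans hle⟩⟩, rfl⟩

theorem clfV_quadratic_lower_bound (S : Set (Equiv.Perm ℝ)) (hS : GeneratesV S) :
    ∃ C : ℝ, 0 < C ∧ ∃ N : ℕ, ∀ n : ℕ, N ≤ n →
      (∃ u v : Equiv.Perm ℝ, MemV u ∧ MemV v ∧ (∃ h, MemV h ∧ h⁻¹ * u * h = v) ∧
        wordLengthWith S u + wordLengthWith S v ≤ n ∧
        ∀ h, MemV h → h⁻¹ * u * h = v → C * (n : ℝ) ^ 2 ≤ (wordLengthWith S h : ℝ)) ∧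
      C * (n : ℝ) ^ 2 ≤ (CLFV S n : ℝ) := by
  obtain ⟨K, B, hK, hpairs⟩ := hS.exists_conjugate_pairs
  have hK' : (0:ℝ) < K := by exact_mod_cast hK
  refine ⟨1 / (4 * K ^ 2 * (B + 1)), by positivity, 4 * K, fun n hn => ?_⟩
  obtain ⟨u, v, hu, hv, hconj, hlen, hlow⟩ := hpairs (n / K - 1)
  have hdiv : 4 ≤ n / K := (Nat.le_div_iff_mul_le hK).2 hn
  have hsucc : n / K - 1 + 1 = n / K := by omega
  have hlen' : wordLengthWith S u + wordLengthWith S v ≤ n := by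
    rw [hsucc] at hlen
    exact hlen.trans (Nat.mul_div_le n K)
  have hscale : (n : ℝ) ≤ 2 * K * (n / K - 1 : ℕ) := by
    have h1 : n < K * (n / K + 1) := Nat.lt_mul_div_succ n hK
    have h2 : n ≤ 2 * K * (n / K - 1) := by
      obtain ⟨r, hr⟩ : ∃ r, n / K = r + 4 := ⟨n / K - 4, by omega⟩
      rw [hr] at h1 ⊢
      have : r + 4 - 1 = r + 3 := by omega
      rw [this]
      nlinarith
    exact_mod_cast h2
  have hbound : ∀ h, MemV h → h⁻¹ * u * h = v →
      1 / (4 * K ^ 2 * (B + 1)) * (n : ℝ) ^ 2 ≤ (wordLengthWith S h : ℝ) := by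
    intro h hh hc
    have h1 : ((n / K - 1 : ℕ) : ℝ) * (n / K - 1 : ℕ) ≤ wordLengthWith S h * B := by
      exact_mod_cast hlow h hh hc
    rw [one_div_mul_eq_div, div_le_iff₀ (by positivity)]
    calc (n : ℝ) ^ 2 ≤ (2 * K * (n / K - 1 : ℕ)) ^ 2 := by gcongr
      _ = 4 * K ^ 2 * (((n / K - 1 : ℕ) : ℝ) * (n / K - 1 : ℕ)) := by ring
      _ ≤ 4 * K ^ 2 * (wordLengthWith S h * B) := by gcongr
      _ ≤ 4 * K ^ 2 * (wordLengthWith S h * (B + 1)) := by gcongr; linarith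
      _ = _ := by ring
  refine ⟨⟨u, v, hu, hv, hconj, hlen', hbound⟩, ?_⟩
  obtain ⟨h, hh, hc, hd⟩ := Nat.sInf_mem
    (s := {n | ∃ h, MemV h ∧ h⁻¹ * u * h = v ∧ wordLengthWith S h = n})
    (by obtain ⟨h, hh, hc⟩ := hconj; exact ⟨_, h, hh, hc, rfl⟩)
  have hle : wordLengthWith S h ≤ CLFV S n := by
    rw [hd]
    exact le_csSup (hS.bddAbove_conjDistV n) ⟨u, v, hu, hv, hconj, hlen', rfl⟩
  exact (hbound h hh hc).trans (by exact_mod_cast hle)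

end
end
end
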